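/- arXiv:1407.8009 — 2 statements merged into one kernel-verified Lean document; each statement's English description precedes it below -/
import Mathlib

section
/- Let μ, ν, ν′ ∈ M satisfy μ ≤_{C,+} ν, μ ≤_{C,+} ν′ and ν(ℝ) = ν′(ℝ). Then W(S^ν(μ), S^{ν′}(μ)) ≤ 2 W(ν, ν′): the shadow projection of a fixed source μ is 2-Lipschitz in its target for the Kantorovich distance. -/
open MeasureTheory Set Filter ProbabilityTheory

noncomputable section

/-- A function has at most linear growth. -/
def LinGrowth (φ : ℝ → ℝ) : Prop := ∃ C : ℝ, ∀ x : ℝ, |φ x| ≤ C * (1 + |x|)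

/-- Membership in `M`: finite positive Borel measure on `ℝ` with finite first moment. -/
def MemM (μ : Measure ℝ) : Prop := IsFiniteMeasure μ ∧ Integrable (fun x => x) μ

/-- Stochastic order `≤_sto`. -/
def leSto (μ ν : Measure ℝ) : Prop :=
  ∀ φ : ℝ → ℝ, LinGrowth φ → Monotone φ → ∫ x, φ x ∂μ ≤ ∫ x, φ x ∂ν

/-- Convex order `≤_C`. -/
def leC (μ ν : Measure ℝ) : Prop :=
  ∀ φ : ℝ → ℝ, LinGrowth φ → ConvexOn ℝ Set.univ φ → ∫ x, φ x ∂μ ≤ ∫ x, φ x ∂ν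

/-- Order `≤_{C,+}` (extended order). -/
def leCP (μ ν : Measure ℝ) : Prop :=
  ∀ φ : ℝ → ℝ, LinGrowth φ → ConvexOn ℝ Set.univ φ → (∀ x, 0 ≤ φ x) →
    ∫ x, φ x ∂μ ≤ ∫ x, φ x ∂ν

/-- Order `≤_{sto,+}`. -/
def leStoP (μ ν : Measure ℝ) : Prop :=
  ∀ φ : ℝ → ℝ, LinGrowth φ → Monotone φ → (∀ x, 0 ≤ φ x) →
    ∫ x, φ x ∂μ ≤ ∫ x, φ x ∂ν

/-- Order `≤_{C,sto}`. -/
def leCS (μ ν : Measure ℝ) : Prop :=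
  ∀ φ : ℝ → ℝ, LinGrowth φ → ConvexOn ℝ Set.univ φ → Monotone φ →
    ∫ x, φ x ∂μ ≤ ∫ x, φ x ∂ν

/-- Order `≤_{C,+,sto}`. -/
def leCPS (μ ν : Measure ℝ) : Prop :=
  ∀ φ : ℝ → ℝ, LinGrowth φ → ConvexOn ℝ Set.univ φ → (∀ x, 0 ≤ φ x) → Monotone φ →
    ∫ x, φ x ∂μ ≤ ∫ x, φ x ∂ν

/-- The Kantorovich distance. -/
def W (μ ν : Measure ℝ) : ℝ :=
  sSup {d : ℝ | ∃ f : ℝ → ℝ, LipschitzWith 1 f ∧ d = |∫ x, f x ∂μ - ∫ x, f x ∂ν|}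

/-- Quantile function `G_ν`. -/
def quantile (ν : Measure ℝ) (t : ℝ) : ℝ := sInf {x : ℝ | t ≤ (ν (Set.Iic x)).toReal}

/-- `IsShadow μ ν η` means `η = S^ν(μ)`, the shadow of `μ` in `ν`. -/
def IsShadow (μ ν η : Measure ℝ) : Prop :=
  leC μ η ∧ η ≤ ν ∧ ∀ η' : Measure ℝ, leC μ η' → η' ≤ ν → leC η η'

/-- `Top(μ,ν)`: pushforward of Lebesgue measure on `(0, m]` by `max (G_μ) (G_ν)`. -/
def TopMeas (μ ν : Measure ℝ) : Measure ℝ :=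
  Measure.map (fun t => max (quantile μ t) (quantile ν t))
    (volume.restrict (Set.Ioc (0:ℝ) (μ Set.univ).toReal))

/-- `Down(μ,ν)`: pushforward of Lebesgue measure on `(0, m]` by `min (G_μ) (G_ν)`. -/
def DownMeas (μ ν : Measure ℝ) : Measure ℝ :=
  Measure.map (fun t => min (quantile μ t) (quantile ν t))
    (volume.restrict (Set.Ioc (0:ℝ) (μ Set.univ).toReal))

/-- Support of a measure on a topological space. -/
def mSupport {α : Type*} [TopologicalSpace α] [MeasurableSpace α] (μ : Measure α) : Set α :=
  {x | ∀ U ∈ nhds x, μ U ≠ 0}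

/-- Positive part (Jordan decomposition) of the signed measure `η - μ`. -/
def posPartSub (η μ : Measure ℝ) [IsFiniteMeasure η] [IsFiniteMeasure μ] : Measure ℝ :=
  (η.toSignedMeasure - μ.toSignedMeasure).toJordanDecomposition.posPart

/-- `π` is a martingale coupling of `μ` and `ν`. -/
def IsMartCoupling (π : Measure (ℝ × ℝ)) (μ ν : Measure ℝ) : Prop :=
  IsProbabilityMeasure π ∧ π.fst = μ ∧ π.snd = ν ∧
    ∀ f : ℝ → ℝ, Continuous f → (∃ C : ℝ, ∀ x, |f x| ≤ C) →
      ∫ p : ℝ × ℝ, f p.1 * (p.2 - p.1) ∂π = 0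

/-- A coupling is left-monotone. -/
def LeftMonotone (π : Measure (ℝ × ℝ)) : Prop :=
  ∃ Γ : Set (ℝ × ℝ), MeasurableSet Γ ∧ π Γ = 1 ∧
    ∀ x ym yp x' y' : ℝ, (x, ym) ∈ Γ → (x, yp) ∈ Γ → (x', y') ∈ Γ →
      x < x' → ym < yp → y' ∉ Set.Ioo ym yp

/-- The set `A` of points `x` with `π((-∞,x) × (x,∞)) = 0`. -/
def jumpSet (π : Measure (ℝ × ℝ)) : Set ℝ := {x | π (Set.Iio x ×ˢ Set.Ioi x) = 0}

/-- The set `A⁻` of points of `A` isolated on the right in `A`. -/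
def jumpSetMinus (π : Measure (ℝ × ℝ)) : Set ℝ :=
  {x ∈ jumpSet π | ∃ ε > 0, Set.Ioo x (x + ε) ∩ jumpSet π = ∅}

/-- Normalised fiber measure `π_x`. -/
def fiberMeasure (π : Measure (ℝ × ℝ)) (x : ℝ) : Measure ℝ :=
  (π.fst {x})⁻¹ • Measure.snd (π.restrict ({x} ×ˢ Set.univ))

/-- The reduced support `spt* π`. -/
def sptStar (π : Measure (ℝ × ℝ)) : Set (ℝ × ℝ) :=
  (mSupport π \ (jumpSetMinus π ×ˢ (Set.univ : Set ℝ))) ∪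
    ⋃ x ∈ {x : ℝ | 0 < π.fst {x}}, {x} ×ˢ mSupport (fiberMeasure π x)

/-- The potential `x ↦ ∫ (x - y)⁺ dμ(y)` of a measure. -/
def pot (μ : Measure ℝ) (x : ℝ) : ℝ := ∫ y, max (x - y) 0 ∂μ

/-- The bounded ramp decreasing with slope `-1` between `a` and `b` and vanishing to the right. -/
def ramp (a b x : ℝ) : ℝ := max (b - x) 0 - max (a - x) 0

/-- A piecewise affine function with slopes `-s i` on `[u i, u (i + 1)]`. -/
def rampSum (s u : ℕ → ℝ) (m : ℕ) (x : ℝ) : ℝ :=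
  ∑ i ∈ Finset.range m, s i * ramp (u i) (u (i + 1)) x

lemma lipschitzWith_hinge (x : ℝ) : LipschitzWith 1 (fun y : ℝ => max (x - y) 0) := by
  have h : LipschitzWith 1 (fun y : ℝ => x - y) := by
    apply LipschitzWith.of_dist_le_mul
    intro a b
    rw [NNReal.coe_one, one_mul, Real.dist_eq, Real.dist_eq, sub_sub_sub_cancel_left, abs_sub_comm]
  simpa using h.max_const 0

lemma integrable_of_lipschitzWith {μ : Measure ℝ} [IsFiniteMeasure μ]
    (hi : Integrable (fun x => x) μ) {K : NNReal} {f : ℝ → ℝ} (hf : LipschitzWith K f) :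
    Integrable f μ := by
  have hb : Integrable (fun x : ℝ => |f 0| + K * |x|) μ :=
    (integrable_const _).add (hi.abs.const_mul _)
  refine hb.mono' hf.continuous.aestronglyMeasurable (Eventually.of_forall fun x => ?_)
  have := hf.dist_le_mul x 0
  rw [Real.dist_eq, Real.dist_eq, sub_zero] at this
  rw [Real.norm_eq_abs]
  have := abs_sub_abs_le_abs_sub (f x) (f 0)
  linarith

lemma integrable_hinge {μ : Measure ℝ} [IsFiniteMeasure μ]
    (hi : Integrable (fun x => x) μ) (x : ℝ) : Integrable (fun y => max (x - y) 0) μ :=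
  integrable_of_lipschitzWith hi (lipschitzWith_hinge x)

lemma integral_rampSum {μ : Measure ℝ} [IsFiniteMeasure μ] (hi : Integrable (fun x => x) μ)
    (s u : ℕ → ℝ) (m : ℕ) :
    ∫ x, rampSum s u m x ∂μ =
      ∑ i ∈ Finset.range m, s i * (pot μ (u (i + 1)) - pot μ (u i)) := by
  unfold rampSum ramp pot
  rw [integral_finsetSum]
  · refine Finset.sum_congr rfl fun i _ => ?_
    rw [integral_const_mul, integral_sub (integrable_hinge hi _) (integrable_hinge hi _)]
  · intro i _
    exact ((integrable_hinge hi _).sub (integrable_hinge hi _)).const_mul _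

lemma antitone_ramp {a b : ℝ} (hab : a ≤ b) : Antitone (ramp a b) := by
  intro x y hxy
  unfold ramp
  rcases max_cases (b - x) 0 with h1 | h1 <;> rcases max_cases (a - x) 0 with h2 | h2 <;>
  rcases max_cases (b - y) 0 with h3 | h3 <;> rcases max_cases (a - y) 0 with h4 | h4 <;>
  linarith

lemma ramp_sub_le (a b : ℝ) {x y : ℝ} (hxy : x ≤ y) : ramp a b x - ramp a b y ≤ y - x := by
  unfold ramp
  rcases max_cases (b - x) 0 with h1 | h1 <;> rcases max_cases (a - x) 0 with h2 | h2 <;>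
  rcases max_cases (b - y) 0 with h3 | h3 <;> rcases max_cases (a - y) 0 with h4 | h4 <;>
  linarith

lemma lipschitzWith_rampSum {s u : ℕ → ℝ} (hs : ∀ i, |s i| ≤ 1) (hu : Monotone u) (m : ℕ) :
    LipschitzWith 1 (rampSum s u m) := by
  have key : ∀ x y : ℝ, x ≤ y → |rampSum s u m x - rampSum s u m y| ≤ y - x := by
    intro x y hxy
    calc |rampSum s u m x - rampSum s u m y|
        = |∑ i ∈ Finset.range m,
            s i * (ramp (u i) (u (i + 1)) x - ramp (u i) (u (i + 1)) y)| := by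
          simp only [rampSum, ← Finset.sum_sub_distrib, mul_sub]
      _ ≤ ∑ i ∈ Finset.range m,
            |s i * (ramp (u i) (u (i + 1)) x - ramp (u i) (u (i + 1)) y)| :=
          Finset.abs_sum_le_sum_abs _ _
      _ ≤ ∑ i ∈ Finset.range m, (ramp (u i) (u (i + 1)) x - ramp (u i) (u (i + 1)) y) := by
          refine Finset.sum_le_sum fun i _ => ?_
          have h0 : 0 ≤ ramp (u i) (u (i + 1)) x - ramp (u i) (u (i + 1)) y :=
            sub_nonneg.2 (antitone_ramp (hu (Nat.le_succ i)) hxy)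
          rw [abs_mul, abs_of_nonneg h0]
          exact mul_le_of_le_one_left h0 (hs i)
      _ = ramp (u 0) (u m) x - ramp (u 0) (u m) y := by
          simp only [ramp]
          rw [Finset.sum_sub_distrib,
            Finset.sum_range_sub (fun i => max (u i - x) 0),
            Finset.sum_range_sub (fun i => max (u i - y) 0)]
      _ ≤ y - x := ramp_sub_le _ _ hxy
  apply LipschitzWith.of_dist_le_mul
  intro x y
  rw [Real.dist_eq, Real.dist_eq, NNReal.coe_one, one_mul]
  rcases le_total x y with h | h
  · rw [abs_of_nonpos (sub_nonpos.2 h)]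
    linarith [key x y h]
  · rw [abs_sub_comm, abs_of_nonneg (sub_nonneg.2 h)]
    exact key y x h

/-- The equidistant grid of mesh `1 / (N + 1)` starting at `-(N + 1)`. -/
def grid (N i : ℕ) : ℝ := -(N + 1) + i / (N + 1)

/-- The negative slopes of the affine interpolation of `φ` along `grid N`. -/
def gridSlope (φ : ℝ → ℝ) (N i : ℕ) : ℝ := (φ (grid N i) - φ (grid N (i + 1))) * (N + 1)

lemma grid_succ_sub (N i : ℕ) : grid N (i + 1) - grid N i = 1 / (N + 1) := by
  unfold grid
  push_cast
  ring

lemma monotone_grid (N : ℕ) : Monotone (grid N) := by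
  refine monotone_nat_of_le_succ fun i => ?_
  have : (0 : ℝ) ≤ 1 / (N + 1) := by positivity
  linarith [grid_succ_sub N i]

lemma grid_zero (N : ℕ) : grid N 0 = -(N + 1) := by simp [grid]

lemma grid_last (N : ℕ) : grid N (2 * (N + 1) ^ 2) = N + 1 := by
  have : (N : ℝ) + 1 ≠ 0 := by positivity
  unfold grid
  push_cast
  field_simp
  ring

lemma grid_mid (N : ℕ) : grid N ((N + 1) ^ 2) = 0 := by
  have : (N : ℝ) + 1 ≠ 0 := by positivity
  unfold grid
  push_cast
  field_simp
  ring

lemma abs_gridSlope_le {φ : ℝ → ℝ} (hφ : LipschitzWith 1 φ) (N i : ℕ) :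
    |gridSlope φ N i| ≤ 1 := by
  have h := hφ.dist_le_mul (grid N i) (grid N (i + 1))
  have hN : (0 : ℝ) < N + 1 := by positivity
  rw [Real.dist_eq, Real.dist_eq, abs_sub_comm (grid N i), grid_succ_sub, NNReal.coe_one, one_mul,
    abs_of_pos (one_div_pos.2 hN)] at h
  unfold gridSlope
  rw [abs_mul, abs_of_pos hN]
  calc _ ≤ 1 / ((N : ℝ) + 1) * (N + 1) := by gcongr
    _ = 1 := by field_simp

lemma rampSum_gridSlope (φ : ℝ → ℝ) (N j m : ℕ) (hj : j ≤ m) :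
    rampSum (gridSlope φ N) (grid N) m (grid N j) = φ (grid N j) - φ (grid N m) := by
  induction m, hj using Nat.le_induction with
  | base =>
    rw [sub_self, rampSum]
    refine Finset.sum_eq_zero fun i hi => ?_
    have h1 : grid N (i + 1) ≤ grid N j := monotone_grid N (Finset.mem_range.1 hi)
    have h2 : grid N i ≤ grid N j := (monotone_grid N (Nat.le_succ i)).trans h1
    rw [ramp, max_eq_right (by linarith), max_eq_right (by linarith)]
    ring
  | succ m hj ih =>
    have h1 : grid N j ≤ grid N m := monotone_grid N hj
    have h2 : grid N m ≤ grid N (m + 1) := monotone_grid N (Nat.le_succ m)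
    rw [rampSum, Finset.sum_range_succ, ← rampSum, ih, ramp, max_eq_left (by linarith),
      max_eq_left (by linarith)]
    have h3 : grid N (m + 1) - grid N j - (grid N m - grid N j) = 1 / (N + 1) := by
      rw [← grid_succ_sub N m]; ring
    have : (N : ℝ) + 1 ≠ 0 := by positivity
    rw [h3, gridSlope]
    field_simp
    ring

/-- The affine interpolation of `φ` along `grid N`. -/
def gridInterp (φ : ℝ → ℝ) (N : ℕ) (x : ℝ) : ℝ :=
  φ (N + 1) + rampSum (gridSlope φ N) (grid N) (2 * (N + 1) ^ 2) x

lemma abs_gridInterp_sub_le {φ : ℝ → ℝ} (hφ : LipschitzWith 1 φ) (N j : ℕ)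
    (hj : j ≤ 2 * (N + 1) ^ 2) (x : ℝ) : |gridInterp φ N x - φ x| ≤ 2 * |x - grid N j| := by
  have h1 := hφ.dist_le_mul (grid N j) x
  have h2 := (lipschitzWith_rampSum (abs_gridSlope_le hφ N) (monotone_grid N)
    (2 * (N + 1) ^ 2)).dist_le_mul x (grid N j)
  rw [rampSum_gridSlope φ N j _ hj, grid_last] at h2
  simp only [Real.dist_eq, NNReal.coe_one, one_mul] at h1 h2
  rw [abs_sub_comm (grid N j)] at h1
  have h3 : gridInterp φ N x - φ x =
      (rampSum (gridSlope φ N) (grid N) (2 * (N + 1) ^ 2) x - (φ (grid N j) - φ (N + 1))) +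
        (φ (grid N j) - φ x) := by
    unfold gridInterp; ring
  rw [h3]
  exact (abs_add_le _ _).trans (by linarith)

lemma tendsto_gridInterp {φ : ℝ → ℝ} (hφ : LipschitzWith 1 φ) (x : ℝ) :
    Tendsto (fun N => gridInterp φ N x) atTop (nhds (φ x)) := by
  rw [tendsto_iff_dist_tendsto_zero]
  have hlim : Tendsto (fun N : ℕ => 2 * (1 / ((N : ℝ) + 1))) atTop (nhds 0) := by
    simpa using (tendsto_one_div_add_atTop_nhds_zero_nat (𝕜 := ℝ)).const_mul 2
  refine tendsto_of_tendsto_of_tendsto_of_le_of_le' tendsto_const_nhds hlim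
    (Eventually.of_forall fun N => dist_nonneg) ?_
  filter_upwards [eventually_ge_atTop ⌈|x|⌉₊] with N hN
  have hN' : |x| ≤ N := (Nat.le_ceil _).trans (by exact_mod_cast hN)
  have hx := abs_le.1 hN'
  have hpos : (0 : ℝ) < N + 1 := by positivity
  set j := ⌊(x + (N + 1)) * (N + 1)⌋₊ with hj
  have hnn : 0 ≤ (x + (N + 1)) * ((N : ℝ) + 1) := mul_nonneg (by linarith) hpos.le
  have h1 : (j : ℝ) ≤ (x + (N + 1)) * (N + 1) := Nat.floor_le hnn
  have h2 : (x + (N + 1)) * (N + 1) < j + 1 := Nat.lt_floor_add_one _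
  have hjle : j ≤ 2 * (N + 1) ^ 2 := by
    have : (j : ℝ) ≤ ((2 * (N + 1) ^ 2 : ℕ) : ℝ) := by
      push_cast
      nlinarith
    exact_mod_cast this
  rw [Real.dist_eq]
  refine (abs_gridInterp_sub_le hφ N j hjle x).trans ?_
  have h3 : x - grid N j = ((x + (N + 1)) * (N + 1) - j) / (N + 1) := by
    unfold grid
    field_simp
    ring
  rw [h3, abs_of_nonneg (div_nonneg (by linarith) hpos.le)]
  gcongr
  linarith

lemma tendsto_integral_gridInterp {μ : Measure ℝ} [IsFiniteMeasure μ]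
    (hi : Integrable (fun x => x) μ) {φ : ℝ → ℝ} (hφ : LipschitzWith 1 φ) :
    Tendsto (fun N : ℕ => φ (N + 1) * μ.real univ + ∑ i ∈ Finset.range (2 * (N + 1) ^ 2),
      gridSlope φ N i * (pot μ (grid N (i + 1)) - pot μ (grid N i))) atTop
      (nhds (∫ x, φ x ∂μ)) := by
  have hlip : ∀ N, LipschitzWith 1
      (rampSum (gridSlope φ N) (grid N) (2 * (N + 1) ^ 2)) := fun N =>
    lipschitzWith_rampSum (abs_gridSlope_le hφ N) (monotone_grid N) _
  have h : Tendsto (fun N : ℕ => ∫ x, gridInterp φ N x ∂μ) atTop (nhds (∫ x, φ x ∂μ)) := by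
    refine tendsto_integral_of_dominated_convergence (fun x => |φ x| + 2 * |x|) (fun N => ?_)
      ((integrable_of_lipschitzWith hi hφ).abs.add (hi.abs.const_mul 2)) (fun N => ?_)
      (Eventually.of_forall fun x => tendsto_gridInterp hφ x)
    · exact (continuous_const.add (hlip N).continuous).aestronglyMeasurable
    · refine Eventually.of_forall fun x => ?_
      have h1 := abs_gridInterp_sub_le hφ N ((N + 1) ^ 2) (by omega) x
      rw [grid_mid, sub_zero] at h1
      rw [Real.norm_eq_abs]
      linarith [abs_sub_abs_le_abs_sub (gridInterp φ N x) (φ x)]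
  refine h.congr fun N => ?_
  unfold gridInterp
  rw [integral_add (integrable_const _) (integrable_of_lipschitzWith hi (hlip N)),
    integral_rampSum hi, integral_const, smul_eq_mul, mul_comm]

/-- The variation of the difference of potentials bounds differences of Lipschitz integrals. -/
lemma abs_integral_sub_le_of_pot {μ μ' : Measure ℝ} [IsFiniteMeasure μ] [IsFiniteMeasure μ']
    (hi : Integrable (fun x => x) μ) (hi' : Integrable (fun x => x) μ')
    (hm : μ.real univ = μ'.real univ) {B : ℝ}
    (hB : ∀ u : ℕ → ℝ, Monotone u → ∀ m : ℕ, ∑ i ∈ Finset.range m,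
      |(pot μ (u (i + 1)) - pot μ' (u (i + 1))) - (pot μ (u i) - pot μ' (u i))| ≤ B)
    {φ : ℝ → ℝ} (hφ : LipschitzWith 1 φ) : |∫ x, φ x ∂μ - ∫ x, φ x ∂μ'| ≤ B := by
  refine le_of_tendsto ((tendsto_integral_gridInterp hi hφ).sub
    (tendsto_integral_gridInterp hi' hφ)).abs (Eventually.of_forall fun N => ?_)
  refine le_trans ?_ (hB (grid N) (monotone_grid N) (2 * (N + 1) ^ 2))
  rw [hm, add_sub_add_left_eq_sub, ← Finset.sum_sub_distrib]
  refine (Finset.abs_sum_le_sum_abs _ _).trans (Finset.sum_le_sum fun i _ => ?_)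
  rw [← mul_sub, abs_mul]
  refine (mul_le_of_le_one_left (abs_nonneg _) (abs_gridSlope_le hφ N i)).trans (le_of_eq ?_)
  congr 1
  ring

lemma bddAbove_W {μ μ' : Measure ℝ} [IsFiniteMeasure μ] [IsFiniteMeasure μ']
    (hi : Integrable (fun x => x) μ) (hi' : Integrable (fun x => x) μ')
    (hm : μ.real univ = μ'.real univ) :
    BddAbove {d : ℝ | ∃ f : ℝ → ℝ, LipschitzWith 1 f ∧
      d = |∫ x, f x ∂μ - ∫ x, f x ∂μ'|} := by
  refine ⟨∫ x, |x| ∂μ + ∫ x, |x| ∂μ', ?_⟩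
  rintro d ⟨f, hf, rfl⟩
  have key : ∀ (ρ : Measure ℝ) [IsFiniteMeasure ρ], Integrable (fun x => x) ρ →
      |∫ x, f x ∂ρ - f 0 * ρ.real univ| ≤ ∫ x, |x| ∂ρ := by
    intro ρ _ hρ
    have h1 : ∫ x, f x ∂ρ - f 0 * ρ.real univ = ∫ x, (f x - f 0) ∂ρ := by
      rw [integral_sub (integrable_of_lipschitzWith hρ hf) (integrable_const _), integral_const,
        smul_eq_mul, mul_comm]
    rw [h1]
    refine abs_integral_le_integral_abs.trans (integral_mono ?_ hρ.abs fun x => ?_)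
    · exact ((integrable_of_lipschitzWith hρ hf).sub (integrable_const _)).abs
    · simpa [Real.dist_eq] using hf.dist_le_mul x 0
  have h1 := abs_le.1 (key μ hi)
  have h2 := abs_le.1 (key μ' hi')
  rw [hm] at h1
  rw [abs_le]
  constructor <;> linarith [h1.1, h1.2, h2.1, h2.2]

lemma sum_abs_pot_sub_le_W {μ μ' : Measure ℝ} [IsFiniteMeasure μ] [IsFiniteMeasure μ']
    (hi : Integrable (fun x => x) μ) (hi' : Integrable (fun x => x) μ')
    (hm : μ.real univ = μ'.real univ) {u : ℕ → ℝ} (hu : Monotone u) (m : ℕ) :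
    ∑ i ∈ Finset.range m,
      |(pot μ (u (i + 1)) - pot μ' (u (i + 1))) - (pot μ (u i) - pot μ' (u i))| ≤ W μ μ' := by
  set e : ℕ → ℝ := fun i =>
    (pot μ (u (i + 1)) - pot μ' (u (i + 1))) - (pot μ (u i) - pot μ' (u i)) with he
  set s : ℕ → ℝ := fun i => SignType.sign (e i) with hs
  have hs1 : ∀ i, |s i| ≤ 1 := by
    intro i
    rcases lt_trichotomy (e i) 0 with h | h | h <;> simp [hs, h]
  refine le_trans ?_ (le_csSup (bddAbove_W hi hi' hm)
    ⟨rampSum s u m, lipschitzWith_rampSum hs1 hu m, rfl⟩)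
  refine le_trans (le_of_eq ?_) (le_abs_self _)
  rw [integral_rampSum hi, integral_rampSum hi', ← Finset.sum_sub_distrib]
  refine Finset.sum_congr rfl fun i _ => ?_
  rw [← mul_sub]
  have : pot μ (u (i + 1)) - pot μ (u i) - (pot μ' (u (i + 1)) - pot μ' (u i)) = e i := by
    simp only [he]; ring
  rw [this]
  simp only [hs]
  exact (sign_mul_self (e i)).symm

lemma convexOn_hinge_left (x : ℝ) : ConvexOn ℝ univ (fun y : ℝ => max (x - y) 0) :=
  ((convexOn_const x convex_univ).sub (concaveOn_id convex_univ)).sup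
    (convexOn_const 0 convex_univ)

lemma convexOn_hinge_right (y : ℝ) : ConvexOn ℝ univ (fun x : ℝ => max (x - y) 0) :=
  ((convexOn_id convex_univ).sub (concaveOn_const y convex_univ)).sup
    (convexOn_const 0 convex_univ)

lemma linGrowth_of_lipschitzWith {K : NNReal} {f : ℝ → ℝ} (hf : LipschitzWith K f) :
    LinGrowth f := by
  refine ⟨|f 0| + K, fun x => ?_⟩
  have h := hf.dist_le_mul x 0
  rw [Real.dist_eq, Real.dist_eq, sub_zero] at h
  have := abs_sub_abs_le_abs_sub (f x) (f 0)
  have := mul_nonneg (abs_nonneg (f 0)) (abs_nonneg x)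
  have := K.coe_nonneg
  nlinarith

lemma pot_nonneg (μ : Measure ℝ) (x : ℝ) : 0 ≤ pot μ x :=
  integral_nonneg fun _ => le_max_right _ _

lemma pot_add {μ ν : Measure ℝ} {x : ℝ} (hμ : Integrable (fun y => max (x - y) 0) μ)
    (hν : Integrable (fun y => max (x - y) 0) ν) : pot (μ + ν) x = pot μ x + pot ν x :=
  integral_add_measure hμ hν

lemma pot_le_of_leC {μ ν : Measure ℝ} (h : leC μ ν) (x : ℝ) : pot μ x ≤ pot ν x :=
  h _ (linGrowth_of_lipschitzWith (lipschitzWith_hinge x)) (convexOn_hinge_left x)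

lemma pot_le_of_leCP {μ ν : Measure ℝ} (h : leCP μ ν) (x : ℝ) : pot μ x ≤ pot ν x :=
  h _ (linGrowth_of_lipschitzWith (lipschitzWith_hinge x)) (convexOn_hinge_left x)
    fun _ => le_max_right _ _

lemma real_univ_eq_of_leC {μ ν : Measure ℝ} (h : leC μ ν) : μ.real univ = ν.real univ := by
  have h1 := h (fun _ => 1) ⟨1, fun x => by simp⟩ (convexOn_const _ convex_univ)
  have h2 := h (fun _ => -1) ⟨1, fun x => by simp⟩ (convexOn_const _ convex_univ)
  simp only [integral_const, smul_eq_mul, mul_one, mul_neg, neg_le_neg_iff] at h1 h2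
  exact le_antisymm h1 h2

section Pot

variable {μ : Measure ℝ} [IsFiniteMeasure μ] (hi : Integrable (fun x => x) μ)
include hi

lemma convexOn_pot : ConvexOn ℝ univ (pot μ) := by
  refine ⟨convex_univ, fun x _ y _ a b ha hb hab => ?_⟩
  simp only [pot, smul_eq_mul]
  rw [← integral_const_mul, ← integral_const_mul,
    ← integral_add ((integrable_hinge hi _).const_mul _) ((integrable_hinge hi _).const_mul _)]
  exact integral_mono (integrable_hinge hi _)
    (((integrable_hinge hi _).const_mul _).add ((integrable_hinge hi _).const_mul _))
    fun z => (convexOn_hinge_right z).2 (mem_univ x) (mem_univ y) ha hb hab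

lemma tendsto_pot_atBot : Tendsto (pot μ) atBot (nhds 0) := by
  have h : Tendsto (fun x => ∫ y, max (x - y) 0 ∂μ) atBot (nhds (∫ _, (0 : ℝ) ∂μ)) := by
    refine tendsto_integral_filter_of_dominated_convergence (fun y => |y|)
      (Eventually.of_forall fun x => (integrable_hinge hi x).aestronglyMeasurable) ?_ hi.abs
      (Eventually.of_forall fun y => ?_)
    · filter_upwards [eventually_le_atBot 0] with x hx
      refine Eventually.of_forall fun y => ?_
      rw [Real.norm_of_nonneg (le_max_right _ _)]
      exact max_le (by linarith [neg_abs_le y]) (abs_nonneg y)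
    · refine tendsto_const_nhds.congr' ?_
      filter_upwards [eventually_le_atBot y] with x hx
      rw [max_eq_right (by linarith)]
  rwa [integral_zero] at h

lemma pot_sub_affine (x : ℝ) :
    pot μ x - (x * μ.real univ - ∫ y, y ∂μ) = ∫ y, max (y - x) 0 ∂μ := by
  have h : x * μ.real univ - ∫ y, y ∂μ = ∫ y, (x - y) ∂μ := by
    rw [integral_sub (integrable_const _) hi, integral_const, smul_eq_mul, mul_comm]
  have hs : Integrable (fun y => x - y) μ := (integrable_const x).sub hi
  rw [h, pot, ← integral_sub (integrable_hinge hi x) hs]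
  refine integral_congr_ae (Eventually.of_forall fun y => ?_)
  change max (x - y) 0 - (x - y) = max (y - x) 0
  rcases le_total x y with h | h
  · rw [max_eq_right (by linarith), max_eq_left (by linarith)]
    ring
  · rw [max_eq_left (by linarith), max_eq_right (by linarith)]
    ring

lemma tendsto_pot_sub_affine_atTop :
    Tendsto (fun x => pot μ x - (x * μ.real univ - ∫ y, y ∂μ)) atTop (nhds 0) := by
  simp only [pot_sub_affine hi]
  have h : Tendsto (fun x => ∫ y, max (y - x) 0 ∂μ) atTop (nhds (∫ _, (0 : ℝ) ∂μ)) := by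
    refine tendsto_integral_filter_of_dominated_convergence (fun y => |y|)
      (Eventually.of_forall fun x => Continuous.aestronglyMeasurable (by fun_prop)) ?_ hi.abs
      (Eventually.of_forall fun y => ?_)
    · filter_upwards [eventually_ge_atTop 0] with x hx
      refine Eventually.of_forall fun y => ?_
      rw [Real.norm_of_nonneg (le_max_right _ _)]
      exact max_le (by linarith [le_abs_self y]) (abs_nonneg y)
    · refine tendsto_const_nhds.congr' ?_
      filter_upwards [eventually_ge_atTop y] with x hx
      rw [max_eq_right (by linarith)]
  simpa using h

lemma tendsto_pot_add_one_sub :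
    Tendsto (fun x => pot μ (x + 1) - pot μ x) atTop (nhds (μ.real univ)) := by
  have h1 := tendsto_pot_sub_affine_atTop hi
  have h2 := ((h1.comp (tendsto_atTop_add_const_right atTop (1 : ℝ) tendsto_id)).sub h1).add_const
    (μ.real univ)
  rw [sub_zero, zero_add] at h2
  refine h2.congr fun x => ?_
  simp only [Function.comp, id]
  ring

lemma pot_add_one_sub_le (x : ℝ) : pot μ (x + 1) - pot μ x ≤ μ.real univ := by
  unfold pot
  rw [← integral_sub (integrable_hinge hi _) (integrable_hinge hi _)]
  have : μ.real univ = ∫ _, (1 : ℝ) ∂μ := by simp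
  rw [this]
  refine integral_mono ((integrable_hinge hi _).sub (integrable_hinge hi _))
    (integrable_const _) fun y => ?_
  have := le_max_left (x - y) 0
  have := le_max_right (x - y) 0
  have : max (x + 1 - y) 0 ≤ 1 + max (x - y) 0 := max_le (by linarith) (by linarith)
  change max (x + 1 - y) 0 - max (x - y) 0 ≤ 1
  linarith

end Pot

lemma tendsto_pot_slope {μ : Measure ℝ} [IsFiniteMeasure μ]
    (hh : ∀ x, Integrable (fun y => max (x - y) 0) μ) (x : ℝ) :
    Tendsto (fun n : ℕ => ((n : ℝ) + 1) * (pot μ (x + 1 / ((n : ℝ) + 1)) - pot μ x)) atTop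
      (nhds (μ.real (Iic x))) := by
  have h : Tendsto (fun n : ℕ => ∫ y, ((n : ℝ) + 1) *
      (max (x + 1 / ((n : ℝ) + 1) - y) 0 - max (x - y) 0) ∂μ) atTop
      (nhds (∫ y, (Iic x).indicator 1 y ∂μ)) := by
    refine tendsto_integral_of_dominated_convergence (fun _ => 1)
      (fun n => Continuous.aestronglyMeasurable (by fun_prop)) (integrable_const _) (fun n => ?_)
      (Eventually.of_forall fun y => ?_)
    · refine Eventually.of_forall fun y => ?_
      have hn : (0 : ℝ) < n + 1 := by positivity
      have hd : (0 : ℝ) < 1 / (n + 1) := by positivity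
      have h1 : max (x - y) 0 ≤ max (x + 1 / ((n : ℝ) + 1) - y) 0 :=
        max_le_max_right _ (by linarith)
      have := le_max_left (x - y) 0
      have := le_max_right (x - y) 0
      have h2 : max (x + 1 / ((n : ℝ) + 1) - y) 0 ≤ 1 / (n + 1) + max (x - y) 0 :=
        max_le (by linarith) (by linarith)
      rw [Real.norm_of_nonneg (mul_nonneg hn.le (by linarith))]
      calc _ ≤ ((n : ℝ) + 1) * (1 / (n + 1)) := by gcongr; linarith
        _ = 1 := by field_simp
    · rcases le_or_gt y x with hy | hy
      · rw [indicator_of_mem (mem_Iic.2 hy)]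
        refine tendsto_const_nhds.congr fun n => ?_
        have hd : (0 : ℝ) < 1 / (n + 1) := by positivity
        rw [max_eq_left (by linarith), max_eq_left (by linarith)]
        have hn : (n : ℝ) + 1 ≠ 0 := by positivity
        simp only [Pi.one_apply]
        field_simp
        ring
      · rw [indicator_of_notMem (by simpa using hy)]
        refine tendsto_const_nhds.congr' ?_
        have := (tendsto_one_div_add_atTop_nhds_zero_nat (𝕜 := ℝ)).eventually
          (gt_mem_nhds (sub_pos.2 hy))
        filter_upwards [this] with n hn
        rw [max_eq_right (by linarith), max_eq_right (by linarith)]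
        ring
  rw [integral_indicator_one measurableSet_Iic] at h
  refine h.congr fun n => ?_
  rw [integral_const_mul, integral_sub (hh _) (hh _)]
  rfl

lemma measure_eq_of_pot_eq {μ ν : Measure ℝ} [IsFiniteMeasure μ] [IsFiniteMeasure ν]
    (hμ : ∀ x, Integrable (fun y => max (x - y) 0) μ)
    (hν : ∀ x, Integrable (fun y => max (x - y) 0) ν) (h : pot μ = pot ν) : μ = ν := by
  refine Measure.ext_of_Iic μ ν fun x => ?_
  have h1 := tendsto_pot_slope hμ x
  rw [h] at h1
  have h2 := tendsto_nhds_unique h1 (tendsto_pot_slope hν x)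
  exact (measureReal_eq_measureReal_iff).1 h2

lemma slope_le_of_linGrowth {φ : ℝ → ℝ} (hφ : ConvexOn ℝ univ φ) {C : ℝ}
    (hC : ∀ x, |φ x| ≤ C * (1 + |x|)) {x y : ℝ} (hxy : x < y) : φ y - φ x ≤ C * (y - x) := by
  have hlim : Tendsto (fun n : ℕ => C * (y - x) +
      (C * (1 + |y|) + C * (1 + |y|)) * (y - x) * (1 / ((n : ℝ) + 1))) atTop
      (nhds (C * (y - x))) := by
    simpa using (tendsto_one_div_add_atTop_nhds_zero_nat (𝕜 := ℝ)).const_mul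
      ((C * (1 + |y|) + C * (1 + |y|)) * (y - x)) |>.const_add (C * (y - x))
  refine ge_of_tendsto hlim (Eventually.of_forall fun n => ?_)
  have hn : (0 : ℝ) < n + 1 := by positivity
  have h1 := hφ.slope_mono_adjacent (mem_univ x) (mem_univ (y + (n + 1))) hxy
    (by linarith : y < y + (n + 1))
  have h2 := (abs_le.1 (hC (y + (n + 1)))).2
  have h3 := (abs_le.1 (hC y)).1
  have hC0 : 0 ≤ C := by
    have := (abs_nonneg _).trans (hC 0)
    simpa using this
  have h4 : |y + ((n : ℝ) + 1)| ≤ |y| + (n + 1) := (abs_add_le _ _).trans (by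
    rw [abs_of_pos hn])
  rw [add_sub_cancel_left, div_le_div_iff₀ (by linarith) hn] at h1
  have h5 : φ (y + (n + 1)) - φ y ≤ C * (1 + |y|) + C * (1 + |y|) + C * (n + 1) := by
    have := mul_le_mul_of_nonneg_left h4 hC0
    linarith
  have h6 : (φ y - φ x) * (n + 1) ≤
      (C * (1 + |y|) + C * (1 + |y|) + C * (n + 1)) * (y - x) :=
    h1.trans (mul_le_mul_of_nonneg_right h5 (by linarith))
  rw [← le_div_iff₀ hn] at h6
  refine h6.trans (le_of_eq ?_)
  field_simp
  ring

lemma lipschitzWith_of_convexOn_linGrowth {φ : ℝ → ℝ} (hφ : ConvexOn ℝ univ φ) {C : ℝ}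
    (hC : ∀ x, |φ x| ≤ C * (1 + |x|)) : LipschitzWith C.toNNReal φ := by
  have hC0 : 0 ≤ C := by
    have := (abs_nonneg _).trans (hC 0)
    simpa using this
  have hneg : ConvexOn ℝ univ (fun x => φ (-x)) := by
    refine ⟨convex_univ, fun x _ y _ a b ha hb hab => ?_⟩
    have := hφ.2 (mem_univ (-x)) (mem_univ (-y)) ha hb hab
    have e : -(a • x + b • y) = a • -x + b • -y := by simp only [smul_eq_mul]; ring
    change φ (-(a • x + b • y)) ≤ _
    rwa [e]
  have key : ∀ x y, x < y → |φ x - φ y| ≤ C * (y - x) := by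
    intro x y hxy
    have h1 := slope_le_of_linGrowth hφ hC hxy
    have h2 := slope_le_of_linGrowth hneg (C := C) (fun x => by simpa using hC (-x))
      (neg_lt_neg hxy)
    simp only [neg_neg] at h2
    rw [abs_le]
    constructor <;> linarith
  refine LipschitzWith.of_dist_le_mul fun x y => ?_
  rw [Real.dist_eq, Real.dist_eq, Real.coe_toNNReal C hC0]
  rcases lt_trichotomy x y with h | rfl | h
  · rw [abs_sub_comm x y, abs_of_pos (sub_pos.2 h)]
    exact key x y h
  · simp
  · rw [abs_sub_comm (φ x), abs_of_pos (sub_pos.2 h)]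
    exact key y x h

lemma sum_mul_sub_ge {s E : ℕ → ℝ} (hs : Antitone s) (hs1 : ∀ i, |s i| ≤ 1)
    (hE : ∀ i, 0 ≤ E i) (m : ℕ) :
    -(E 0 + E m) ≤ ∑ i ∈ Finset.range m, s i * (E (i + 1) - E i) := by
  have key : ∀ m : ℕ, s m * E m - s 0 * E 0 ≤ ∑ i ∈ Finset.range m, s i * (E (i + 1) - E i) := by
    intro m
    induction m with
    | zero => simp
    | succ m ih =>
      rw [Finset.sum_range_succ]
      have := mul_le_mul_of_nonneg_right (hs (Nat.le_succ m)) (hE (m + 1))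
      simp only [Nat.succ_eq_add_one] at this
      linarith
  have h1 := (abs_le.1 (hs1 m)).1
  have h2 := (abs_le.1 (hs1 0)).2
  have := key m
  nlinarith [hE 0, hE m]

lemma antitone_gridSlope {φ : ℝ → ℝ} (hφ : ConvexOn ℝ univ φ) (N : ℕ) :
    Antitone (gridSlope φ N) := by
  refine antitone_nat_of_succ_le fun i => ?_
  have hN : (0 : ℝ) < N + 1 := by positivity
  have hd : (0 : ℝ) < 1 / (N + 1) := by positivity
  have h1 := grid_succ_sub N i
  have h2 := grid_succ_sub N (i + 1)
  have h := hφ.slope_mono_adjacent (mem_univ (grid N i)) (mem_univ (grid N (i + 1 + 1)))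
    (by linarith : grid N i < grid N (i + 1)) (by linarith)
  rw [h1, h2, div_le_div_iff_of_pos_right hd] at h
  unfold gridSlope
  exact mul_le_mul_of_nonneg_right (by linarith) hN.le

/-- Potentials characterise the convex order. -/
lemma leC_of_pot_le {μ η : Measure ℝ} [IsFiniteMeasure μ] [IsFiniteMeasure η]
    (hμ : Integrable (fun x => x) μ) (hη : Integrable (fun x => x) η)
    (hm : μ.real univ = η.real univ) (hle : ∀ x, pot μ x ≤ pot η x)
    (hbot : Tendsto (fun x => pot η x - pot μ x) atBot (nhds 0))
    (htop : Tendsto (fun x => pot η x - pot μ x) atTop (nhds 0)) : leC μ η := by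
  have key : ∀ φ : ℝ → ℝ, LipschitzWith 1 φ → ConvexOn ℝ univ φ →
      ∫ x, φ x ∂μ ≤ ∫ x, φ x ∂η := by
    intro φ hlip hconv
    have hN : Tendsto (fun N : ℕ => (N : ℝ) + 1) atTop atTop :=
      tendsto_atTop_add_const_right _ _ tendsto_natCast_atTop_atTop
    have h0 : Tendsto (fun N : ℕ => -((pot η (grid N 0) - pot μ (grid N 0)) +
        (pot η (grid N (2 * (N + 1) ^ 2)) - pot μ (grid N (2 * (N + 1) ^ 2))))) atTop
        (nhds 0) := by
      simp only [grid_zero, grid_last]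
      simpa using ((hbot.comp (tendsto_neg_atTop_atBot.comp hN)).add (htop.comp hN)).neg
    have h1 := (tendsto_integral_gridInterp hη hlip).sub (tendsto_integral_gridInterp hμ hlip)
    rw [← sub_nonneg]
    refine le_of_tendsto_of_tendsto h0 h1 (Eventually.of_forall fun N => ?_)
    refine (sum_mul_sub_ge (antitone_gridSlope hconv N) (abs_gridSlope_le hlip N)
      (E := fun i => pot η (grid N i) - pot μ (grid N i)) (fun i => sub_nonneg.2 (hle _))
      (2 * (N + 1) ^ 2)).trans (le_of_eq ?_)
    rw [hm]
    beta_reduce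
    rw [add_sub_add_left_eq_sub, ← Finset.sum_sub_distrib]
    refine Finset.sum_congr rfl fun i _ => ?_
    ring
  rintro φ ⟨C, hC⟩ hconv
  have hC0 : 0 ≤ C := by
    have := (abs_nonneg _).trans (hC 0)
    simpa using this
  have hlip := lipschitzWith_of_convexOn_linGrowth hconv hC
  have hpos : 0 < (C + 1)⁻¹ := by positivity
  have h := key (fun x => (C + 1)⁻¹ * φ x) ?_ (hconv.smul hpos.le)
  · rw [integral_const_mul, integral_const_mul] at h
    exact le_of_mul_le_mul_left h hpos
  · refine LipschitzWith.of_dist_le_mul fun x y => ?_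
    have h := hlip.dist_le_mul x y
    rw [Real.coe_toNNReal C hC0] at h
    rw [Real.dist_eq] at h ⊢
    rw [← mul_sub, abs_mul, abs_of_pos hpos, NNReal.coe_one, one_mul, inv_mul_le_iff₀ (by linarith)]
    nlinarith [dist_nonneg (x := x) (y := y)]

/-- The epigraph of `f` over `I`. -/
def epi (I : Set ℝ) (f : ℝ → ℝ) : Set (ℝ × ℝ) := {p | p.1 ∈ I ∧ f p.1 ≤ p.2}

/-- The largest convex minorant of `f` over `I`. -/
def env (I : Set ℝ) (f : ℝ → ℝ) (x : ℝ) : ℝ := sInf {r | (x, r) ∈ convexHull ℝ (epi I f)}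

section Env

variable {I : Set ℝ} {f : ℝ → ℝ}

lemma le_of_mem_convexHull_epi {g : ℝ → ℝ} (hg : ConvexOn ℝ I g) (hgf : ∀ x ∈ I, g x ≤ f x)
    {x r : ℝ} (h : (x, r) ∈ convexHull ℝ (epi I f)) : x ∈ I ∧ g x ≤ r := by
  have : convexHull ℝ (epi I f) ⊆ {p : ℝ × ℝ | p.1 ∈ I ∧ g p.1 ≤ p.2} :=
    convexHull_min (fun p hp => ⟨hp.1, (hgf _ hp.1).trans hp.2⟩) hg.convex_epigraph
  exact this h

lemma self_mem_convexHull_epi {x : ℝ} (hx : x ∈ I) : (x, f x) ∈ convexHull ℝ (epi I f) :=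
  subset_convexHull ℝ _ ⟨hx, le_rfl⟩

lemma le_env {g : ℝ → ℝ} (hg : ConvexOn ℝ I g) (hgf : ∀ x ∈ I, g x ≤ f x)
    {x : ℝ} (hx : x ∈ I) : g x ≤ env I f x :=
  le_csInf ⟨f x, self_mem_convexHull_epi hx⟩ fun _ hr => (le_of_mem_convexHull_epi hg hgf hr).2

lemma exists_mem_convexHull_epi_lt {x ε : ℝ} (hx : x ∈ I) (hε : 0 < ε) :
    ∃ r, (x, r) ∈ convexHull ℝ (epi I f) ∧ r < env I f x + ε :=
  exists_lt_of_csInf_lt ⟨f x, self_mem_convexHull_epi hx⟩ (lt_add_of_pos_right _ hε)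

variable (hI : Convex ℝ I) (hf : ∀ x ∈ I, 0 ≤ f x)
include hI hf

lemma env_le_of_mem {x r : ℝ} (h : (x, r) ∈ convexHull ℝ (epi I f)) : env I f x ≤ r :=
  csInf_le ⟨0, fun _ hr => (le_of_mem_convexHull_epi (convexOn_const 0 hI) hf hr).2⟩ h

lemma env_le {x : ℝ} (hx : x ∈ I) : env I f x ≤ f x :=
  env_le_of_mem hI hf (self_mem_convexHull_epi hx)

lemma env_nonneg {x : ℝ} (hx : x ∈ I) : 0 ≤ env I f x :=
  le_env (convexOn_const 0 hI) hf hx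

lemma convexOn_env : ConvexOn ℝ I (env I f) := by
  refine ⟨hI, fun x hx y hy a b ha hb hab => le_of_forall_pos_lt_add fun ε hε => ?_⟩
  obtain ⟨r, hr, hr'⟩ := exists_mem_convexHull_epi_lt (f := f) hx hε
  obtain ⟨s, hs, hs'⟩ := exists_mem_convexHull_epi_lt (f := f) hy hε
  have h := env_le_of_mem hI hf (convex_convexHull ℝ (epi I f) hr hs ha hb hab)
  simp only [Prod.smul_mk, smul_eq_mul] at h ⊢
  refine h.trans_lt ?_
  rcases ha.eq_or_lt with rfl | ha
  · obtain rfl : b = 1 := by linarith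
    linarith
  · have h1 := mul_lt_mul_of_pos_left hr' ha
    have h2 := mul_le_mul_of_nonneg_left hs'.le hb
    have h3 : ε = a * ε + b * ε := by rw [← add_mul, hab, one_mul]
    linarith

lemma env_eq_of_forall_le {x : ℝ} (hx : x ∈ I) (h : ∀ y ∈ I, y ≤ x) : env I f x = f x := by
  refine le_antisymm (env_le hI hf hx) (le_csInf ⟨f x, self_mem_convexHull_epi hx⟩ fun r hr => ?_)
  have hT : Convex ℝ {p : ℝ × ℝ | p.1 ≤ x ∧ (p.1 = x → f x ≤ p.2)} := by
    rintro ⟨p, p'⟩ ⟨hp, hp'⟩ ⟨q, q'⟩ ⟨hq, hq'⟩ a b ha hb hab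
    simp only [Prod.smul_mk, Prod.mk_add_mk, smul_eq_mul, mem_ofPred_eq] at *
    have h1 : a * p ≤ a * x := mul_le_mul_of_nonneg_left hp ha
    have h2 : b * q ≤ b * x := mul_le_mul_of_nonneg_left hq hb
    have h3 : x = a * x + b * x := by rw [← add_mul, hab, one_mul]
    refine ⟨by linarith, fun he => ?_⟩
    have h4 : a * p = a * x := by linarith
    have h5 : b * q = b * x := by linarith
    have h6 : a * f x ≤ a * p' := by
      rcases ha.eq_or_lt with rfl | ha
      · simp
      · exact mul_le_mul_of_nonneg_left (hp' (mul_left_cancel₀ ha.ne' h4)) ha.le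
    have h7 : b * f x ≤ b * q' := by
      rcases hb.eq_or_lt with rfl | hb
      · simp
      · exact mul_le_mul_of_nonneg_left (hq' (mul_left_cancel₀ hb.ne' h5)) hb.le
    have h8 : f x = a * f x + b * f x := by rw [← add_mul, hab, one_mul]
    linarith
  exact (convexHull_min (t := {p : ℝ × ℝ | p.1 ≤ x ∧ (p.1 = x → f x ≤ p.2)})
    (fun p hp => ⟨h _ hp.1, fun he => he ▸ hp.2⟩) hT hr).2 rfl

lemma env_eq_of_forall_ge {x : ℝ} (hx : x ∈ I) (h : ∀ y ∈ I, x ≤ y) : env I f x = f x := by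
  refine le_antisymm (env_le hI hf hx) (le_csInf ⟨f x, self_mem_convexHull_epi hx⟩ fun r hr => ?_)
  have hT : Convex ℝ {p : ℝ × ℝ | x ≤ p.1 ∧ (p.1 = x → f x ≤ p.2)} := by
    rintro ⟨p, p'⟩ ⟨hp, hp'⟩ ⟨q, q'⟩ ⟨hq, hq'⟩ a b ha hb hab
    simp only [Prod.smul_mk, Prod.mk_add_mk, smul_eq_mul, mem_ofPred_eq] at *
    have h1 : a * x ≤ a * p := mul_le_mul_of_nonneg_left hp ha
    have h2 : b * x ≤ b * q := mul_le_mul_of_nonneg_left hq hb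
    have h3 : x = a * x + b * x := by rw [← add_mul, hab, one_mul]
    refine ⟨by linarith, fun he => ?_⟩
    have h4 : a * p = a * x := by linarith
    have h5 : b * q = b * x := by linarith
    have h6 : a * f x ≤ a * p' := by
      rcases ha.eq_or_lt with rfl | ha
      · simp
      · exact mul_le_mul_of_nonneg_left (hp' (mul_left_cancel₀ ha.ne' h4)) ha.le
    have h7 : b * f x ≤ b * q' := by
      rcases hb.eq_or_lt with rfl | hb
      · simp
      · exact mul_le_mul_of_nonneg_left (hq' (mul_left_cancel₀ hb.ne' h5)) hb.le
    have h8 : f x = a * f x + b * f x := by rw [← add_mul, hab, one_mul]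
    linarith
  exact (convexHull_min (t := {p : ℝ × ℝ | x ≤ p.1 ∧ (p.1 = x → f x ≤ p.2)})
    (fun p hp => ⟨h _ hp.1, fun he => he ▸ hp.2⟩) hT hr).2 rfl

end Env

lemma exists_weights_of_mem_convexHull_epi {I : Set ℝ} {f : ℝ → ℝ} {x r : ℝ}
    (h : (x, r) ∈ convexHull ℝ (epi I f)) :
    ∃ (ι : Type) (_ : Fintype ι) (w a : ι → ℝ), (∀ i, 0 ≤ w i) ∧ ∑ i, w i = 1 ∧
      (∀ i, a i ∈ I) ∧ ∑ i, w i * a i = x ∧ ∑ i, w i * f (a i) ≤ r := by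
  obtain ⟨ι, _, w, z, hw0, hw1, hz, hx⟩ := mem_convexHull_iff_exists_fintype.1 h
  refine ⟨ι, inferInstance, w, fun i => (z i).1, hw0, hw1, fun i => (hz i).1, ?_, ?_⟩
  · have := congrArg Prod.fst hx
    simpa [Prod.fst_sum] using this
  · have := congrArg Prod.snd hx
    rw [Prod.snd_sum] at this
    simp only [Prod.smul_snd, smul_eq_mul] at this
    rw [← this]
    exact Finset.sum_le_sum fun i _ => mul_le_mul_of_nonneg_left (hz i).2 (hw0 i)

lemma env_le_sum {I : Set ℝ} {f : ℝ → ℝ} (hI : Convex ℝ I) (hf : ∀ x ∈ I, 0 ≤ f x)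
    {ι : Type*} [Fintype ι] {w a : ι → ℝ} (hw0 : ∀ i, 0 ≤ w i) (hw1 : ∑ i, w i = 1)
    (ha : ∀ i, a i ∈ I) :
    ∑ i, w i * a i ∈ I ∧ env I f (∑ i, w i * a i) ≤ ∑ i, w i * f (a i) := by
  refine ⟨hI.sum_mem (fun i _ => hw0 i) hw1 fun i _ => ha i, ?_⟩
  have h := (convexOn_env hI hf).map_sum_le (t := Finset.univ) (w := w) (p := a)
    (fun i _ => hw0 i) hw1 fun i _ => ha i
  simp only [smul_eq_mul] at h
  exact h.trans (Finset.sum_le_sum fun i _ =>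
    mul_le_mul_of_nonneg_left (env_le hI hf (ha i)) (hw0 i))

/-- The convex envelope preserves the order of slopes. -/
lemma env_add_env_le {I : Set ℝ} {f k : ℝ → ℝ} (hI : Convex ℝ I) (hf : ∀ x ∈ I, 0 ≤ f x)
    (hk : ∀ x ∈ I, 0 ≤ k x) (hmono : MonotoneOn (fun x => k x - f x) I) :
    MonotoneOn (fun x => env I k x - env I f x) I := by
  intro x hx y hy hxy
  beta_reduce
  suffices h : env I k x + env I f y ≤ env I f x + env I k y by linarith
  refine le_of_forall_pos_le_add fun ε hε => ?_
  obtain ⟨r, hr, hr'⟩ := exists_mem_convexHull_epi_lt (f := f) hx (half_pos hε)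
  obtain ⟨s, hs, hs'⟩ := exists_mem_convexHull_epi_lt (f := k) hy (half_pos hε)
  obtain ⟨ι, _, w, a, hw0, hw1, ha, hax, har⟩ := exists_weights_of_mem_convexHull_epi hr
  obtain ⟨κ, _, v, b, hv0, hv1, hb, hby, hbs⟩ := exists_weights_of_mem_convexHull_epi hs
  have hp0 : ∀ i : ι × κ, 0 ≤ w i.1 * v i.2 := fun i => mul_nonneg (hw0 _) (hv0 _)
  have hp1 : ∑ i : ι × κ, w i.1 * v i.2 = 1 := by
    rw [Fintype.sum_prod_type, ← Finset.sum_mul_sum, hw1, hv1, one_mul]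
  have hL : ∀ g : ι → ℝ, ∑ i : ι × κ, w i.1 * v i.2 * g i.1 = ∑ i, w i * g i := by
    intro g
    rw [Fintype.sum_prod_type]
    refine Finset.sum_congr rfl fun i _ => ?_
    dsimp only
    rw [← Finset.sum_mul, ← Finset.mul_sum, hv1, mul_one]
  have hR : ∀ g : κ → ℝ, ∑ i : ι × κ, w i.1 * v i.2 * g i.2 = ∑ j, v j * g j := by
    intro g
    rw [Fintype.sum_prod_type_right]
    refine Finset.sum_congr rfl fun i _ => ?_
    dsimp only
    rw [← Finset.sum_mul, ← Finset.sum_mul, hw1, one_mul]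
  have hmin : ∀ i : ι × κ, min (a i.1) (b i.2) ∈ I := fun i => by
    rcases min_choice (a i.1) (b i.2) with h | h <;> rw [h]
    exacts [ha _, hb _]
  have hmax : ∀ i : ι × κ, max (a i.1) (b i.2) ∈ I := fun i => by
    rcases max_choice (a i.1) (b i.2) with h | h <;> rw [h]
    exacts [ha _, hb _]
  obtain ⟨hAI, hA⟩ := env_le_sum hI hk hp0 hp1 hmin
  obtain ⟨hBI, hB⟩ := env_le_sum hI hf hp0 hp1 hmax
  set A := ∑ i : ι × κ, w i.1 * v i.2 * min (a i.1) (b i.2) with hAdef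
  set B := ∑ i : ι × κ, w i.1 * v i.2 * max (a i.1) (b i.2) with hBdef
  have hAB : A + B = x + y := by
    rw [hAdef, hBdef, ← Finset.sum_add_distrib, ← hax, ← hby, ← hL a, ← hR b,
      ← Finset.sum_add_distrib]
    refine Finset.sum_congr rfl fun i _ => ?_
    rw [← mul_add, min_add_max, mul_add]
  have hAx : A ≤ x := by
    rw [hAdef, ← hax, ← hL a]
    exact Finset.sum_le_sum fun i _ => mul_le_mul_of_nonneg_left (min_le_left _ _) (hp0 i)
  have hsum : env I k A + env I f B ≤ r + s := by
    refine (add_le_add hA hB).trans (le_trans ?_ (add_le_add har hbs))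
    rw [← hL (fun i => f (a i)), ← hR (fun j => k (b j)), ← Finset.sum_add_distrib,
      ← Finset.sum_add_distrib]
    refine Finset.sum_le_sum fun i _ => ?_
    rw [← mul_add, ← mul_add]
    refine mul_le_mul_of_nonneg_left ?_ (hp0 i)
    rcases le_total (a i.1) (b i.2) with h | h
    · rw [min_eq_left h, max_eq_right h]
      have := hmono (ha i.1) (hb i.2) h
      simp only at this
      linarith
    · rw [min_eq_right h, max_eq_left h]
      linarith
  obtain ⟨p, q, hp, hq, hpq, hx'⟩ : ∃ p q : ℝ, 0 ≤ p ∧ 0 ≤ q ∧ p + q = 1 ∧ p * A + q * y = x := by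
    have : x ∈ segment ℝ A y := by
      rw [segment_eq_Icc (hAx.trans hxy)]
      exact ⟨hAx, hxy⟩
    obtain ⟨p, q, hp, hq, hpq, h⟩ := this
    exact ⟨p, q, hp, hq, hpq, h⟩
  have hy' : p * B + q * x = y := by
    have h1 : B = x + y - A := by linarith
    have h2 : p = 1 - q := by linarith
    subst h2
    rw [h1]
    linarith
  have c1 := (convexOn_env hI hk).2 hAI hy hp hq hpq
  have c2 := (convexOn_env hI hf).2 hBI hx hp hq hpq
  simp only [smul_eq_mul] at c1 c2
  rw [hx'] at c1
  rw [hy'] at c2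
  have h1 : p * (env I k A + env I f B) ≤ p * (env I f x + env I k y + ε) :=
    mul_le_mul_of_nonneg_left (by linarith) hp
  have h2 : 0 ≤ q * ε := mul_nonneg hq hε.le
  have h3 : env I f x + env I k y + ε =
      p * (env I f x + env I k y + ε) + q * (env I f x + env I k y + ε) := by
    rw [← add_mul, hpq, one_mul]
  linarith

lemma env_anti_set {I J : Set ℝ} {f : ℝ → ℝ} (hIJ : I ⊆ J) (hJ : Convex ℝ J)
    (hf : ∀ x ∈ J, 0 ≤ f x) {x : ℝ} (hx : x ∈ I) : env J f x ≤ env I f x :=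
  le_csInf ⟨f x, self_mem_convexHull_epi hx⟩ fun _ hr =>
    env_le_of_mem hJ hf (convexHull_mono (fun _ hp => ⟨hIJ hp.1, hp.2⟩ : epi I f ⊆ epi J f) hr)

lemma tendsto_env_Icc {f : ℝ → ℝ} (hf : ∀ x, 0 ≤ f x) (x : ℝ) :
    Tendsto (fun n : ℕ => env (Icc (-(n : ℝ)) n) f x) atTop (nhds (env univ f x)) := by
  rw [tendsto_order]
  have hx : ∀ᶠ n : ℕ in atTop, x ∈ Icc (-(n : ℝ)) n := by
    filter_upwards [eventually_ge_atTop ⌈|x|⌉₊] with n hn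
    exact abs_le.1 ((Nat.le_ceil _).trans (by exact_mod_cast hn))
  constructor
  · intro c hc
    filter_upwards [hx] with n hn
    exact hc.trans_le (env_anti_set (subset_univ _) convex_univ (fun x _ => hf x) hn)
  · intro c hc
    obtain ⟨r, hr, hr'⟩ := exists_mem_convexHull_epi_lt (f := f) (mem_univ x) (sub_pos.2 hc)
    rw [add_sub_cancel] at hr'
    obtain ⟨ι, _, w, a, hw0, hw1, -, hax, har⟩ := exists_weights_of_mem_convexHull_epi hr
    filter_upwards [eventually_ge_atTop ⌈∑ i, |a i|⌉₊] with n hn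
    have hn' : ∑ i, |a i| ≤ n := (Nat.le_ceil _).trans (by exact_mod_cast hn)
    have ha : ∀ i, a i ∈ Icc (-(n : ℝ)) n := fun i => abs_le.1 <|
      (Finset.single_le_sum (f := fun i => |a i|) (fun i _ => abs_nonneg _)
        (Finset.mem_univ i)).trans hn'
    have := (env_le_sum (convex_Icc (-(n : ℝ)) n) (fun x _ => hf x) hw0 hw1 ha).2
    rw [hax] at this
    linarith

/-- The convex envelope contracts the variation seminorm. -/
lemma sum_abs_env_sub_le {f g : ℝ → ℝ} (hf : ∀ x, 0 ≤ f x) (hg : ∀ x, 0 ≤ g x) {B : ℝ}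
    (hB : ∀ u : ℕ → ℝ, Monotone u → ∀ m : ℕ, ∑ i ∈ Finset.range m,
      |(f (u (i + 1)) - g (u (i + 1))) - (f (u i) - g (u i))| ≤ B)
    {u : ℕ → ℝ} (hu : Monotone u) (m : ℕ) :
    ∑ i ∈ Finset.range m, |(env univ f (u (i + 1)) - env univ g (u (i + 1))) -
      (env univ f (u i) - env univ g (u i))| ≤ B := by
  set h : ℝ → ℝ := fun x => f x - g x with hh
  have hB0 : 0 ≤ B := by simpa using hB u hu 0
  have hvar : eVariationOn h univ ≤ ENNReal.ofReal B := by
    refine iSup_le fun p => ?_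
    simp only [edist_dist, Real.dist_eq]
    rw [← ENNReal.ofReal_sum_of_nonneg fun i _ => abs_nonneg _]
    exact ENNReal.ofReal_le_ofReal (hB p.2.1 p.2.2.1 p.1)
  have hbv : LocallyBoundedVariationOn h univ :=
    BoundedVariationOn.locallyBoundedVariationOn (ne_top_of_le_ne_top ENNReal.ofReal_ne_top hvar)
  have hlim : Tendsto (fun n : ℕ => ∑ i ∈ Finset.range m,
      |(env (Icc (-(n : ℝ)) n) f (u (i + 1)) - env (Icc (-(n : ℝ)) n) g (u (i + 1))) -
        (env (Icc (-(n : ℝ)) n) f (u i) - env (Icc (-(n : ℝ)) n) g (u i))|) atTop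
      (nhds (∑ i ∈ Finset.range m, |(env univ f (u (i + 1)) - env univ g (u (i + 1))) -
        (env univ f (u i) - env univ g (u i))|)) :=
    tendsto_finsetSum _ fun i _ => (((tendsto_env_Icc hf _).sub (tendsto_env_Icc hg _)).sub
      ((tendsto_env_Icc hf _).sub (tendsto_env_Icc hg _))).abs
  refine le_of_tendsto hlim ?_
  filter_upwards [eventually_ge_atTop ⌈|u 0|⌉₊, eventually_ge_atTop ⌈|u m|⌉₊] with n hn0 hnm
  have h0 := abs_le.1 ((Nat.le_ceil _).trans (by exact_mod_cast hn0) : |u 0| ≤ n)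
  have hm := abs_le.1 ((Nat.le_ceil _).trans (by exact_mod_cast hnm) : |u m| ≤ n)
  set I := Icc (-(n : ℝ)) n with hIdef
  have hI : Convex ℝ I := convex_Icc _ _
  have hnn : -(n : ℝ) ≤ n := by linarith [h0.1, h0.2]
  set V : ℝ → ℝ := variationOnFromTo h univ (-(n : ℝ)) with hV
  have hVmono : ∀ x y, x ≤ y → |h y - h x| ≤ V y - V x := by
    intro x y hxy
    have h1 := variationOnFromTo.add hbv (mem_univ (-(n : ℝ))) (mem_univ x) (mem_univ y)
    have h2 : V y - V x = variationOnFromTo h univ x y := by simp only [hV]; linarith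
    rw [h2, variationOnFromTo.eq_of_le _ _ hxy, ← Real.dist_eq, dist_edist]
    exact ENNReal.toReal_mono (hbv x y (mem_univ x) (mem_univ y))
      (eVariationOn.edist_le h ⟨mem_univ y, right_mem_Icc.2 hxy⟩ ⟨mem_univ x, left_mem_Icc.2 hxy⟩)
  have hV0 : V (-(n : ℝ)) = 0 := variationOnFromTo.self _ _ _
  have hVn : V n ≤ B := by
    simp only [hV]
    rw [variationOnFromTo.eq_of_le _ _ hnn]
    exact ENNReal.toReal_le_of_le_ofReal hB0 ((eVariationOn.mono h inter_subset_left).trans hvar)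
  set k : ℝ → ℝ := fun x => f x + (V x - (h x - h (-(n : ℝ)))) / 2 with hk
  have hk0 : ∀ x ∈ I, 0 ≤ k x := by
    intro x hx
    have := (abs_le.1 (hVmono _ x hx.1)).2
    have := hf x
    simp only [hk]
    linarith
  have hkf : MonotoneOn (fun x => k x - f x) I := by
    intro x _ y _ hxy
    have := (abs_le.1 (hVmono x y hxy)).2
    simp only [hk]
    linarith
  have hkg : MonotoneOn (fun x => k x - g x) I := by
    intro x _ y _ hxy
    have := (abs_le.1 (hVmono x y hxy)).1
    simp only [hk, hh] at this ⊢
    linarith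
  have m1 := env_add_env_le hI (fun x _ => hf x) hk0 hkf
  have m2 := env_add_env_le hI (fun x _ => hg x) hk0 hkg
  set T : ℝ → ℝ := fun x => (env I k x - env I f x) + (env I k x - env I g x) with hT
  have hTm : MonotoneOn T I := fun x hx y hy hxy => add_le_add (m1 hx hy hxy) (m2 hx hy hxy)
  have hstep : ∀ x ∈ I, ∀ y ∈ I, x ≤ y →
      |(env I f y - env I g y) - (env I f x - env I g x)| ≤ T y - T x := by
    intro x hx y hy hxy
    have h1 := m1 hx hy hxy
    have h2 := m2 hx hy hxy
    simp only [hT] at h1 h2 ⊢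
    rw [abs_le]
    constructor <;> linarith
  have hmem : ∀ i ≤ m, u i ∈ I := fun i hi =>
    ⟨h0.1.trans (hu (Nat.zero_le i)), (hu hi).trans hm.2⟩
  calc _ ≤ ∑ i ∈ Finset.range m, (T (u (i + 1)) - T (u i)) :=
        Finset.sum_le_sum fun i hi => hstep _ (hmem _ (Finset.mem_range.1 hi).le) _
          (hmem _ (Finset.mem_range.1 hi)) (hu (Nat.le_succ i))
    _ = T (u m) - T (u 0) := Finset.sum_range_sub (fun i => T (u i)) m
    _ ≤ T n - T (-(n : ℝ)) := by
        have h1 := hTm (hmem m le_rfl) (right_mem_Icc.2 hnn) hm.2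
        have h2 := hTm (left_mem_Icc.2 hnn) (hmem 0 (Nat.zero_le m)) h0.1
        linarith
    _ ≤ B := by
        have e1 : ∀ φ : ℝ → ℝ, (∀ x ∈ I, 0 ≤ φ x) → env I φ n = φ n := fun φ hφ =>
          env_eq_of_forall_le hI hφ (right_mem_Icc.2 hnn) fun y hy => hy.2
        have e2 : ∀ φ : ℝ → ℝ, (∀ x ∈ I, 0 ≤ φ x) → env I φ (-(n : ℝ)) = φ (-(n : ℝ)) :=
          fun φ hφ => env_eq_of_forall_ge hI hφ (left_mem_Icc.2 hnn) fun y hy => hy.1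
        simp only [hT]
        rw [e1 k hk0, e1 f fun x _ => hf x, e1 g fun x _ => hg x, e2 k hk0, e2 f fun x _ => hf x,
          e2 g fun x _ => hg x]
        simp only [hk, hh] at hVn ⊢
        linarith

lemma monotone_of_convexOn_of_tendsto_atBot {c : ℝ → ℝ} (hc : ConvexOn ℝ univ c)
    (h0 : Tendsto c atBot (nhds 0)) : Monotone c := by
  refine monotone_iff_forall_lt.2 fun x y hxy => ?_
  have hlim : Tendsto (fun z => (c x - c z) / (x - z)) atBot (nhds 0) :=
    Tendsto.div_atTop (tendsto_const_nhds.sub h0)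
      (tendsto_atTop_add_const_left atBot x tendsto_neg_atBot_atTop)
  have h : 0 ≤ (c y - c x) / (y - x) := by
    refine le_of_tendsto hlim ?_
    filter_upwards [eventually_lt_atBot x] with z hz
    exact hc.slope_mono_adjacent (mem_univ z) (mem_univ y) hz hxy
  rw [le_div_iff₀ (sub_pos.2 hxy), zero_mul] at h
  linarith

lemma ae_nonneg_hinge (μ : Measure ℝ) (x : ℝ) : 0 ≤ᵐ[μ] fun y => max (x - y) 0 :=
  Eventually.of_forall fun _ => le_max_right _ _

section Measure

variable {c : ℝ → ℝ} (hc : ConvexOn ℝ univ c)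
include hc

lemma monotone_rightDeriv : Monotone fun x => derivWithin c (Ioi x) x := by
  have := hc.monotoneOn_rightDeriv
  rwa [interior_univ, monotoneOn_univ] at this

lemma hasDerivWithinAt_rightDeriv (x : ℝ) :
    HasDerivWithinAt c (derivWithin c (Ioi x) x) (Ioi x) x :=
  hc.hasDerivWithinAt_rightDeriv_of_mem_interior (by simp)

lemma rightDeriv_le_add_one_sub (x : ℝ) : derivWithin c (Ioi x) x ≤ c (x + 1) - c x := by
  have := hc.rightDeriv_le_slope_of_mem_interior (by simp) (mem_univ (x + 1)) (lt_add_one x)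
  simpa [slope_def_field] using this

lemma integral_rightDeriv {a b : ℝ} (hab : a ≤ b) :
    ∫ x in a..b, derivWithin c (Ioi x) x = c b - c a :=
  intervalIntegral.integral_eq_sub_of_hasDeriv_right_of_le hab
    ((hc.continuousOn isOpen_univ).mono (subset_univ _))
    (fun x _ => hasDerivWithinAt_rightDeriv hc x) (monotone_rightDeriv hc).intervalIntegrable

/-- The second derivative measure of `c`. -/
def secondDeriv : Measure ℝ := (monotone_rightDeriv hc).stieltjesFunction.measure

lemma stieltjes_ae_eq :
    ∀ᵐ x, (monotone_rightDeriv hc).stieltjesFunction x = derivWithin c (Ioi x) x := by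
  filter_upwards [(monotone_rightDeriv hc).countable_not_continuousAt.ae_notMem volume] with x hx
  have hx : ContinuousAt (fun x => derivWithin c (Ioi x) x) x := by simpa using hx
  exact hx.continuousWithinAt.rightLim_eq

variable (hm : Monotone c)
include hm

lemma stieltjes_nonneg (x : ℝ) : 0 ≤ (monotone_rightDeriv hc).stieltjesFunction x :=
  ((hm.monotoneOn (Ioi x)).derivWithin_nonneg (x := x)).trans
    ((monotone_rightDeriv hc).le_rightLim le_rfl)

omit hm in
lemma stieltjes_le (x : ℝ) :
    (monotone_rightDeriv hc).stieltjesFunction x ≤ c (x + 1 + 1) - c (x + 1) :=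
  ((monotone_rightDeriv hc).rightLim_le (lt_add_one x)).trans (rightDeriv_le_add_one_sub hc _)

lemma isFiniteMeasure_secondDeriv {M : ℝ} (hM : ∀ x, c (x + 1) - c x ≤ M) :
    IsFiniteMeasure (secondDeriv hc) :=
  StieltjesFunction.isFiniteMeasure_of_forall_abs_le (C := M) _ fun x => by
    rw [abs_of_nonneg (stieltjes_nonneg hc hm x)]
    exact (stieltjes_le hc x).trans (hM _)

variable (h0 : Tendsto c atBot (nhds 0))
include h0

lemma secondDeriv_Iic (x : ℝ) :
    secondDeriv hc (Iic x) = ENNReal.ofReal ((monotone_rightDeriv hc).stieltjesFunction x) := by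
  have h : Tendsto (fun x : ℝ => c (x + 1 + 1) - c (x + 1)) atBot (nhds 0) := by
    have h1 : Tendsto (fun x : ℝ => c (x + 1)) atBot (nhds 0) :=
      h0.comp (tendsto_atBot_add_const_right atBot 1 tendsto_id)
    simpa using (h1.comp (tendsto_atBot_add_const_right atBot 1 tendsto_id)).sub h1
  have := StieltjesFunction.measure_Iic (monotone_rightDeriv hc).stieltjesFunction
    (squeeze_zero (stieltjes_nonneg hc hm) (stieltjes_le hc) h) x
  rwa [sub_zero] at this

lemma lintegral_hinge_secondDeriv (k : ℝ) :
    ∫⁻ y, ENNReal.ofReal (max (k - y) 0) ∂(secondDeriv hc) = ENNReal.ofReal (c k) := by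
  set S := (monotone_rightDeriv hc).stieltjesFunction with hS
  rw [lintegral_eq_lintegral_meas_le _ (ae_nonneg_hinge _ _)
    (by fun_prop)]
  have hset : ∀ t ∈ Ioi (0 : ℝ), secondDeriv hc {y | t ≤ max (k - y) 0}
      = ENNReal.ofReal (S (k - t)) := by
    intro t ht
    rw [← secondDeriv_Iic hc hm h0]
    congr 1
    ext y
    simp only [mem_Iic, mem_ofPred_eq, le_max_iff]
    constructor
    · rintro (h | h)
      · linarith
      · exact absurd h (not_le.2 ht)
    · intro h
      left
      linarith
  rw [setLIntegral_congr_fun measurableSet_Ioi hset]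
  have hanti : Antitone fun t => S (k - t) := fun a b hab => S.mono (by linarith)
  have h1 := (aecover_Iic (μ := volume.restrict (Ioi (0 : ℝ)))
    (tendsto_natCast_atTop_atTop (R := ℝ))).lintegral_tendsto_of_countably_generated
    (f := fun t => ENNReal.ofReal (S (k - t)))
    (hanti.measurable.ennreal_ofReal.aemeasurable)
  have h2 : ∀ n : ℕ, ∫⁻ t in Iic (n : ℝ), ENNReal.ofReal (S (k - t)) ∂(volume.restrict (Ioi 0))
      = ENNReal.ofReal (c k - c (k - n)) := by
    intro n
    have hn : (0 : ℝ) ≤ n := n.cast_nonneg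
    have hint : IntervalIntegrable (fun t => S (k - t)) volume 0 n := hanti.intervalIntegrable
    rw [Measure.restrict_restrict measurableSet_Iic, inter_comm, Ioi_inter_Iic,
      ← ofReal_integral_eq_lintegral_ofReal
        ((intervalIntegrable_iff_integrableOn_Ioc_of_le hn).1 hint)
        (Eventually.of_forall fun t => stieltjes_nonneg hc hm _),
      ← intervalIntegral.integral_of_le hn,
      intervalIntegral.integral_comp_sub_left (fun t => S t), sub_zero,
      ← integral_rightDeriv hc (by linarith : k - n ≤ k)]
    congr 1
    refine intervalIntegral.integral_congr_ae ?_
    filter_upwards [stieltjes_ae_eq hc] with x hx _ using hx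
  simp only [h2] at h1
  refine tendsto_nhds_unique h1 ?_
  have h3 : Tendsto (fun n : ℕ => c (k - n)) atTop (nhds 0) := by
    refine h0.comp ?_
    exact tendsto_atBot_add_const_left atTop k
      (tendsto_neg_atTop_atBot.comp tendsto_natCast_atTop_atTop)
  simpa [Function.comp_def] using (ENNReal.continuous_ofReal.tendsto _).comp (h3.const_sub (c k))

end Measure

lemma exists_measure_pot_eq {c : ℝ → ℝ} (hc : ConvexOn ℝ univ c) (hc0 : ∀ x, 0 ≤ c x)
    (h0 : Tendsto c atBot (nhds 0)) {M : ℝ} (hM : ∀ x, c (x + 1) - c x ≤ M) :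
    ∃ θ : Measure ℝ, IsFiniteMeasure θ ∧ (∀ x, Integrable (fun y => max (x - y) 0) θ) ∧
      pot θ = c := by
  have hm := monotone_of_convexOn_of_tendsto_atBot hc h0
  have hl := lintegral_hinge_secondDeriv hc hm h0
  have hae : ∀ x : ℝ, AEStronglyMeasurable (fun y => max (x - y) 0) (secondDeriv hc) :=
    fun x => Continuous.aestronglyMeasurable (by fun_prop)
  refine ⟨secondDeriv hc, isFiniteMeasure_secondDeriv hc hm hM, fun x => ⟨hae x, ?_⟩, ?_⟩
  · rw [hasFiniteIntegral_iff_ofReal (ae_nonneg_hinge _ _), hl]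
    exact ENNReal.ofReal_lt_top
  · ext x
    rw [pot, integral_eq_lintegral_of_nonneg_ae (ae_nonneg_hinge _ _)
      (hae x), hl, ENNReal.toReal_ofReal (hc0 x)]

lemma convexOn_univ_of_exists_slope {f : ℝ → ℝ}
    (h : ∀ p q r, p < q → q < r → ∃ s, f q - f p ≤ s * (q - p) ∧ s * (r - q) ≤ f r - f q) :
    ConvexOn ℝ univ f := by
  refine convexOn_of_slope_mono_adjacent convex_univ fun {p q r} _ _ hpq hqr => ?_
  obtain ⟨s, h1, h2⟩ := h p q r hpq hqr
  exact ((div_le_iff₀ (sub_pos.2 hpq)).2 h1).trans ((le_div_iff₀ (sub_pos.2 hqr)).2 h2)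

lemma ConvexOn.exists_slope {I : Set ℝ} {f : ℝ → ℝ} (hf : ConvexOn ℝ I f) {p q r : ℝ}
    (hp : p ∈ I) (hr : r ∈ I) (hpq : p < q) (hqr : q < r) :
    ∃ s, f q - f p = s * (q - p) ∧ s * (r - q) ≤ f r - f q := by
  refine ⟨(f q - f p) / (q - p), ?_, ?_⟩
  · rw [div_mul_cancel₀ _ (sub_pos.2 hpq).ne']
  · exact (le_div_iff₀ (sub_pos.2 hqr)).1 (hf.slope_mono_adjacent hp hr hpq hqr)

/-- Replacing a convex function on `[x, y]` by its maximum with another convex function agreeing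
with it at `x` and `y` preserves convexity. -/
lemma convexOn_ite_max {c g : ℝ → ℝ} (hc : ConvexOn ℝ univ c) {x y : ℝ}
    (hg : ConvexOn ℝ (Icc x y) g) (hgx : g x = c x) (hgy : g y = c y) :
    ConvexOn ℝ univ fun z => open Classical in if z ∈ Icc x y then max (c z) (g z) else c z := by
  classical
  set k : ℝ → ℝ := fun z => if z ∈ Icc x y then max (c z) (g z) else c z with hk
  have hin : ∀ z ∈ Icc x y, k z = max (c z) (g z) := fun z hz => if_pos hz
  have hout : ∀ z, z ∉ Ioo x y → k z = c z := by
    intro z hz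
    by_cases h : z ∈ Icc x y
    · rw [hin z h]
      rcases eq_or_lt_of_le h.1 with rfl | h1
      · simp [hgx]
      rcases eq_or_lt_of_le h.2 with rfl | h2
      · simp [hgy]
      · exact absurd ⟨h1, h2⟩ hz
    · exact if_neg h
  have hle : ∀ z, c z ≤ k z := by
    intro z
    by_cases h : z ∈ Icc x y
    · exact (hin z h).ge.trans' (le_max_left _ _)
    · exact (if_neg h).ge
  have hM : ConvexOn ℝ (Icc x y) fun z => max (c z) (g z) :=
    (hc.subset (subset_univ _) (convex_Icc x y)).sup hg
  have hk' : ConvexOn ℝ (Icc x y) k := hM.congr fun z hz => (hin z hz).symm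
  refine convexOn_univ_of_exists_slope fun p q r hpq hqr => ?_
  by_cases hq : q ∈ Ioo x y
  · have hx : x ∈ Icc x y := ⟨le_rfl, (hq.1.trans hq.2).le⟩
    have hy : y ∈ Icc x y := ⟨(hq.1.trans hq.2).le, le_rfl⟩
    have hp' : max p x ∈ Icc x y := ⟨le_max_right _ _, max_le (hpq.trans hq.2).le hx.2⟩
    have hr' : min r y ∈ Icc x y := ⟨le_min (hq.1.trans hqr).le hy.1, min_le_right _ _⟩
    obtain ⟨s, h1, h2⟩ := hk'.exists_slope hp' hr' (max_lt hpq hq.1) (lt_min hqr hq.2)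
    refine ⟨s, ?_, ?_⟩
    · rcases le_or_gt x p with h | h
      · rw [max_eq_left h] at h1
        exact h1.le
      · rw [max_eq_right h.le, hout x (by simp)] at h1
        rw [hout p fun hp => absurd hp.1 (not_lt.2 h.le)]
        obtain ⟨t, ht1, ht2⟩ := hc.exists_slope (mem_univ p) (mem_univ q) h hq.1
        have : t * (q - x) ≤ s * (q - x) := by linarith [hle q]
        have := le_of_mul_le_mul_right this (sub_pos.2 hq.1)
        nlinarith
    · rcases le_or_gt r y with h | h
      · rw [min_eq_left h] at h2
        exact h2
      · rw [min_eq_right h.le, hout y (by simp)] at h2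
        rw [hout r fun hr => absurd hr.2 (not_lt.2 h.le)]
        obtain ⟨t, ht1, ht2⟩ := hc.exists_slope (mem_univ q) (mem_univ r) hq.2 h
        have : s * (y - q) ≤ t * (y - q) := by linarith [hle q]
        have := le_of_mul_le_mul_right this (sub_pos.2 hq.2)
        nlinarith
  · obtain ⟨s, h1, h2⟩ := hc.exists_slope (mem_univ p) (mem_univ r) hpq hqr
    rw [hout q hq]
    exact ⟨s, by linarith [hle p], by linarith [hle r]⟩

lemma convexOn_sub_env {A B : ℝ → ℝ} (hA : ConvexOn ℝ univ A) (hB : ConvexOn ℝ univ B)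
    (hBA : ∀ x, B x ≤ A x) : ConvexOn ℝ univ fun x => A x - env univ (fun x => A x - B x) x := by
  have hf : ∀ x ∈ univ, 0 ≤ A x - B x := fun x _ => sub_nonneg.2 (hBA x)
  have hc := convexOn_env convex_univ hf
  have hcf : ∀ x, env univ (fun x => A x - B x) x ≤ A x - B x := fun x =>
    env_le convex_univ hf (mem_univ x)
  set c := env univ (fun x => A x - B x) with hcdef
  refine LinearOrder.convexOn_of_lt convex_univ fun x _ y _ hxy a b ha hb hab => ?_
  have hyx : y - x ≠ 0 := (sub_pos.2 hxy).ne'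
  obtain ⟨s, t, hx, hy⟩ : ∃ s t : ℝ, s * x + t = A x - c x ∧ s * y + t = A y - c y := by
    refine ⟨((A y - c y) - (A x - c x)) / (y - x),
      (A x - c x) - ((A y - c y) - (A x - c x)) / (y - x) * x, by ring, ?_⟩
    field_simp
    ring
  have hg : ConvexOn ℝ (Icc x y) fun z => A z - (s * z + t) := by
    refine ((hA.subset (subset_univ _) (convex_Icc x y)).sub
      (ConcaveOn.add ?_ (concaveOn_const t (convex_Icc x y))))
    exact ⟨convex_Icc x y, fun u _ v _ p q _ _ _ => by simp only [smul_eq_mul]; linarith⟩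
  have hk := convexOn_ite_max hc hg (by rw [hx]; ring) (by rw [hy]; ring)
  set z := a • x + b • y with hz
  have hzm : z ∈ Icc x y :=
    convex_Icc x y (left_mem_Icc.2 hxy.le) (right_mem_Icc.2 hxy.le) ha.le hb.le hab
  have hBL : ∀ w ∈ Icc x y, B w ≤ s * w + t := by
    intro w hw
    have hd : ConvexOn ℝ univ fun z => B z - (s * z + t) := by
      refine hB.sub (ConcaveOn.add ?_ (concaveOn_const t convex_univ))
      exact ⟨convex_univ, fun u _ v _ p q _ _ _ => by simp only [smul_eq_mul]; linarith⟩
    have := hd.le_on_segment (mem_univ x) (mem_univ y) (segment_eq_Icc hxy.le ▸ hw)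
    have h0 : max (B x - (s * x + t)) (B y - (s * y + t)) ≤ 0 :=
      max_le (by linarith [hcf x]) (by linarith [hcf y])
    linarith
  have h1 := le_env hk (f := fun x => A x - B x) (fun w _ => by
    split_ifs with hw
    · exact max_le (hcf w) (by linarith [hBL w hw])
    · exact hcf w) (mem_univ z)
  rw [if_pos hzm] at h1
  have h2 := (le_max_right _ _).trans h1
  have h3 : s * z + t = a * (A x - c x) + b * (A y - c y) := by
    rw [← hx, ← hy, hz]
    simp only [smul_eq_mul]
    linear_combination (-t) * hab
  simp only [smul_eq_mul]
  rw [← h3]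
  linarith

lemma memM_of_le {η ν : Measure ℝ} (hν : MemM ν) (h : η ≤ ν) : MemM η :=
  have := hν.1
  ⟨isFiniteMeasure_of_le ν h, hν.2.mono_measure h⟩

section Shadow

variable {μ ν : Measure ℝ} (h : leCP μ ν)
include h

lemma env_pot_sub_bounds (x : ℝ) : 0 ≤ env univ (fun x => pot ν x - pot μ x) x ∧
    env univ (fun x => pot ν x - pot μ x) x ≤ pot ν x - pot μ x :=
  have hf : ∀ x ∈ univ, 0 ≤ pot ν x - pot μ x := fun x _ => sub_nonneg.2 (pot_le_of_leCP h x)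
  ⟨env_nonneg convex_univ hf (mem_univ x), env_le convex_univ hf (mem_univ x)⟩

lemma convexOn_env_pot_sub : ConvexOn ℝ univ (env univ fun x => pot ν x - pot μ x) :=
  convexOn_env convex_univ fun x _ => sub_nonneg.2 (pot_le_of_leCP h x)

variable (hμ : MemM μ) (hν : MemM ν)
include hμ hν

omit hμ in
lemma tendsto_env_pot_sub_atBot :
    Tendsto (env univ fun x => pot ν x - pot μ x) atBot (nhds 0) := by
  have := hν.1
  refine squeeze_zero (fun x => (env_pot_sub_bounds h x).1) (fun x => ?_)
    (tendsto_pot_atBot hν.2)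
  linarith [(env_pot_sub_bounds h x).2, pot_nonneg μ x]

lemma tendsto_sub_env_atTop : Tendsto
    (fun x => pot ν x - pot μ x - env univ (fun x => pot ν x - pot μ x) x) atTop (nhds 0) := by
  have := hμ.1
  have := hν.1
  have ha : ∀ x, (x * ν.real univ - ∫ y, y ∂ν) - (x * μ.real univ - ∫ y, y ∂μ)
      ≤ pot ν x - pot μ x := by
    intro x
    have hl : LipschitzWith 1 fun y : ℝ => max (y - x) 0 := by
      refine LipschitzWith.of_dist_le_mul fun y z => ?_
      have := abs_max_sub_max_le_abs (y - x) (z - x) 0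
      rw [Real.dist_eq, Real.dist_eq, NNReal.coe_one, one_mul]
      simpa using this
    have := h _ (linGrowth_of_lipschitzWith hl) (convexOn_hinge_right x) fun _ => le_max_right _ _
    rw [← pot_sub_affine hμ.2, ← pot_sub_affine hν.2] at this
    linarith
  have hac : ∀ x, (x * ν.real univ - ∫ y, y ∂ν) - (x * μ.real univ - ∫ y, y ∂μ)
      ≤ env univ (fun x => pot ν x - pot μ x) x := by
    intro x
    refine le_env (g := fun x => (x * ν.real univ - ∫ y, y ∂ν) - (x * μ.real univ - ∫ y, y ∂μ))
      ⟨convex_univ, fun u _ v _ p q _ _ hpq => ?_⟩ (fun x _ => ha x) (mem_univ x)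
    simp only [smul_eq_mul]
    refine le_of_eq ?_
    linear_combination (∫ y, y ∂ν - ∫ y, y ∂μ) * hpq
  have h1 := (tendsto_pot_sub_affine_atTop hν.2).sub (tendsto_pot_sub_affine_atTop hμ.2)
  rw [sub_zero] at h1
  refine squeeze_zero (fun x => ?_) (fun x => ?_) h1
  · linarith [(env_pot_sub_bounds h x).2]
  · linarith [hac x]

/-- There is a submeasure of `ν` above `μ` in convex order with the expected potential. -/
lemma exists_le_pot_eq : ∃ η₀ : Measure ℝ, leC μ η₀ ∧ η₀ ≤ ν ∧
    ∀ x, pot η₀ x = pot ν x - env univ (fun x => pot ν x - pot μ x) x := by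
  have := hμ.1
  have := hν.1
  have hcb := env_pot_sub_bounds h
  have hcc := convexOn_env_pot_sub h
  have hc0 := tendsto_env_pot_sub_atBot h hν
  have htop := tendsto_sub_env_atTop h hμ hν
  have huc := convexOn_sub_env (convexOn_pot hν.2) (convexOn_pot hμ.2) (pot_le_of_leCP h)
  set c := env univ fun x => pot ν x - pot μ x with hc
  have hu0 : Tendsto (fun x => pot ν x - c x) atBot (nhds 0) := by
    simpa using (tendsto_pot_atBot hν.2).sub hc0
  have hcm := monotone_of_convexOn_of_tendsto_atBot hcc hc0
  have hum := monotone_of_convexOn_of_tendsto_atBot huc hu0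
  have hx1 : ∀ x : ℝ, x ≤ x + 1 := fun x => by linarith
  obtain ⟨θ, hθ, hθi, hθp⟩ := exists_measure_pot_eq hcc (fun x => (hcb x).1) hc0
    (M := ν.real univ) fun x => by
      linarith [hum (hx1 x), pot_add_one_sub_le hν.2 x]
  obtain ⟨η₀, hη, hηi, hηp⟩ := exists_measure_pot_eq huc
    (fun x => by linarith [(hcb x).2, pot_nonneg μ x]) hu0 (M := ν.real univ) fun x => by
      linarith [hcm (hx1 x), pot_add_one_sub_le hν.2 x]
  have hsum : η₀ + θ = ν := by
    refine measure_eq_of_pot_eq (fun x => (hηi x).add_measure (hθi x))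
      (fun x => integrable_hinge hν.2 x) ?_
    ext x
    rw [pot_add (hηi x) (hθi x), hθp, hηp]
    ring
  have hle : η₀ ≤ ν := hsum ▸ Measure.le_add_right le_rfl
  have hη2 := (memM_of_le hν hle).2
  have htop' : Tendsto (fun x => pot η₀ x - pot μ x) atTop (nhds 0) := by
    refine htop.congr fun x => ?_
    rw [hηp]
    ring
  refine ⟨η₀, leC_of_pot_le hμ.2 hη2 ?_ (fun x => ?_) ?_ htop', hle, fun x => by rw [hηp]⟩
  · have h1 := (tendsto_pot_add_one_sub hη2).sub (tendsto_pot_add_one_sub hμ.2)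
    have h2 := (htop'.comp (tendsto_atTop_add_const_right atTop (1 : ℝ) tendsto_id)).sub htop'
    rw [sub_zero] at h2
    have h3 := tendsto_nhds_unique h1 (h2.congr fun x => by
      simp only [Function.comp, id]
      ring)
    linarith
  · rw [hηp]
    linarith [(hcb x).2]
  · simpa using (tendsto_pot_atBot hη2).sub (tendsto_pot_atBot hμ.2)

/-- The potential of the shadow is obtained by subtracting a largest convex minorant. -/
theorem pot_shadow {η : Measure ℝ} (hη : IsShadow μ ν η) (x : ℝ) :
    pot η x = pot ν x - env univ (fun x => pot ν x - pot μ x) x := by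
  have := hν.1
  obtain ⟨hμη, hην, hmin⟩ := hη
  refine le_antisymm ?_ ?_
  · obtain ⟨η₀, h1, h2, h3⟩ := exists_le_pot_eq h hμ hν
    exact (pot_le_of_leC (hmin η₀ h1 h2) x).trans_eq (h3 x)
  · have := (memM_of_le hν hην).1
    have hadd : ν - η + η = ν := Measure.sub_add_cancel_of_le hην
    have hsub : MemM (ν - η) := memM_of_le hν Measure.sub_le
    have := hsub.1
    have hpot : ∀ x, pot (ν - η) x = pot ν x - pot η x := fun x => by
      have := pot_add (integrable_hinge hsub.2 x) (integrable_hinge (memM_of_le hν hην).2 x)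
      rw [hadd] at this
      linarith
    have := le_env (convexOn_pot hsub.2) (f := fun x => pot ν x - pot μ x)
      (fun x _ => by linarith [hpot x, pot_le_of_leC hμη x]) (mem_univ x)
    linarith [hpot x]

end Shadow

/-- the shadow projection is 2-Lipschitz in its target. -/
theorem shadow_lipschitz_target (μ ν ν' : Measure ℝ) (hμ : MemM μ) (hν : MemM ν)
    (hν' : MemM ν') (hmass : ν Set.univ = ν' Set.univ)
    (h₁ : leCP μ ν) (h₂ : leCP μ ν')
    (η η' : Measure ℝ) (hη : IsShadow μ ν η) (hη' : IsShadow μ ν' η') :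
    W η η' ≤ 2 * W ν ν' := by
  have := hν.1
  have := hν'.1
  have hηM := memM_of_le hν hη.2.1
  have hηM' := memM_of_le hν' hη'.2.1
  have := hηM.1
  have := hηM'.1
  have hm : ν.real univ = ν'.real univ := by rw [measureReal_def, hmass, measureReal_def]
  have hmη : η.real univ = η'.real univ :=
    (real_univ_eq_of_leC hη.1).symm.trans (real_univ_eq_of_leC hη'.1)
  have hE : ∀ u : ℕ → ℝ, Monotone u → ∀ m, _ := fun u hu m =>
    sum_abs_env_sub_le (f := fun x => pot ν x - pot μ x) (g := fun x => pot ν' x - pot μ x)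
      (fun x => sub_nonneg.2 (pot_le_of_leCP h₁ x)) (fun x => sub_nonneg.2 (pot_le_of_leCP h₂ x))
      (B := W ν ν')
      (fun u hu m => by
        simpa only [sub_sub_sub_cancel_right] using sum_abs_pot_sub_le_W hν.2 hν'.2 hm hu m) hu m
  refine csSup_le ⟨_, fun _ => 0, LipschitzWith.const' 0, rfl⟩ ?_
  rintro _ ⟨φ, hφ, rfl⟩
  refine abs_integral_sub_le_of_pot hηM.2 hηM'.2 hmη (fun u hu m => ?_) hφ
  have h1 := sum_abs_pot_sub_le_W hν.2 hν'.2 hm hu m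
  have h2 := hE u hu m
  rw [two_mul]
  refine le_trans ?_ (add_le_add h1 h2)
  rw [← Finset.sum_add_distrib]
  refine Finset.sum_le_sum fun i _ => ?_
  simp only [pot_shadow h₁ hμ hν hη, pot_shadow h₂ hμ hν' hη']
  refine le_trans (le_of_eq ?_) (abs_sub _ _)
  congr 1
  ring

end
end

section
/- Let μ, ν ∈ M satisfy μ ≤_{C,+} ν, and let (ν_n)_{n∈ℕ} be a sequence in M such that inf(spt ν_n) → +∞ as n → ∞. Then μ ≤_{C,+} ν + ν_n for all large n, and the shadows converge: W(S^{ν+ν_n}(μ), S^ν(μ)) → 0. The same conclusion holds if instead sup(spt ν_n) → −∞, or if ν_n([a_n, b_n]) = 0 for sequences with a_n → −∞ and b_n → +∞. -/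
open MeasureTheory Set Filter ProbabilityTheory

noncomputable section

/-- A bounded family in a real Hilbert space converges weakly along every ultrafilter. -/
lemma exists_weak_limit_of_norm_le {ι E : Type*} [NormedAddCommGroup E] [InnerProductSpace ℝ E]
    [CompleteSpace E] (U : Ultrafilter ι) (v : ι → E) (C : ℝ) (hv : ∀ i, ‖v i‖ ≤ C) :
    ∃ w : E, ∀ g : E, Tendsto (fun i => inner ℝ (v i) g) U (nhds (inner ℝ w g)) := by
  let F : ι → WeakDual ℝ E := fun i =>
    StrongDual.toWeakDual (InnerProductSpace.toDual ℝ E (v i))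
  have hF : ((U.map F : Ultrafilter (WeakDual ℝ E)) : Filter (WeakDual ℝ E)) ≤
      Filter.principal (WeakDual.toStrongDual ⁻¹' Metric.closedBall (0 : StrongDual ℝ E) C) := by
    rw [Filter.le_principal_iff, Ultrafilter.mem_coe, Ultrafilter.mem_map]
    refine Filter.Eventually.of_forall (f := (U : Filter ι)) fun i => ?_
    change InnerProductSpace.toDual ℝ E (v i) ∈ Metric.closedBall (0 : StrongDual ℝ E) C
    simpa [mem_closedBall_zero_iff] using hv i
  obtain ⟨x, -, hx⟩ := (WeakDual.isCompact_closedBall (𝕜 := ℝ) (0 : StrongDual ℝ E) C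
    ).ultrafilter_le_nhds _ hF
  refine ⟨(InnerProductSpace.toDual ℝ E).symm (WeakDual.toStrongDual x), fun g => ?_⟩
  have h1 : Tendsto F U (nhds x) := hx
  have h2 := ((WeakDual.eval_continuous (𝕜 := ℝ) (E := E) g).tendsto x).comp h1
  rw [InnerProductSpace.toDual_symm_apply]
  exact h2

/-- Functions with values in `[0, 1]` have a weak limit along every ultrafilter, tested against
bounded functions. -/
lemma exists_weak_limit_of_mem_Icc {ι α : Type*} [MeasurableSpace α] (lam : Measure α)
    [IsFiniteMeasure lam] (U : Ultrafilter ι) (h : ι → α → ℝ) (hm : ∀ i, Measurable (h i))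
    (hI : ∀ i x, h i x ∈ Set.Icc (0 : ℝ) 1) :
    ∃ f : α → ℝ, Measurable f ∧ (∀ x, f x ∈ Set.Icc (0 : ℝ) 1) ∧
      ∀ (g : α → ℝ) (C : ℝ), Measurable g → (∀ x, |g x| ≤ C) →
        Tendsto (fun i => ∫ x, h i x * g x ∂lam) U (nhds (∫ x, f x * g x ∂lam)) := by
  have hL : ∀ i, MemLp (h i) 2 lam := fun i =>
    MemLp.of_bound (hm i).aestronglyMeasurable 1 (.of_forall fun x => by
      rw [Real.norm_eq_abs, abs_of_nonneg (hI i x).1]; exact (hI i x).2)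
  have h1L : MemLp (fun _ : α => (1 : ℝ)) 2 lam := memLp_const 1
  obtain ⟨w, hw⟩ := exists_weak_limit_of_norm_le U (fun i => (hL i).toLp (h i)) ‖h1L.toLp _‖
    (fun i => by
      refine Lp.norm_le_norm_of_ae_le ?_
      filter_upwards [(hL i).coeFn_toLp, h1L.coeFn_toLp] with x hx hx'
      rw [hx, hx', Real.norm_eq_abs, abs_of_nonneg (hI i x).1]
      simpa using (hI i x).2)
  have key : ∀ (g : α → ℝ) (C : ℝ), Measurable g → (∀ x, |g x| ≤ C) →
      Tendsto (fun i => ∫ x, h i x * g x ∂lam) U (nhds (∫ x, w x * g x ∂lam)) := by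
    intro g C hg hC
    have hgL : MemLp g 2 lam := MemLp.of_bound hg.aestronglyMeasurable C (.of_forall hC)
    convert hw (hgL.toLp g) using 2
    · rename_i i
      rw [L2.inner_def]
      refine integral_congr_ae ?_
      filter_upwards [(hL i).coeFn_toLp, hgL.coeFn_toLp] with x hx hx'
      rw [hx, hx']
      simp [mul_comm]
    · rw [L2.inner_def]
      refine integral_congr_ae ?_
      filter_upwards [hgL.coeFn_toLp] with x hx'
      rw [hx']
      simp [mul_comm]
  have hwi : Integrable w lam := (Lp.memLp w).integrable (by norm_num)
  have hset : ∀ s : Set α, MeasurableSet s →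
      Tendsto (fun i => ∫ x in s, h i x ∂lam) U (nhds (∫ x in s, w x ∂lam)) := by
    intro s hs
    have := key (s.indicator fun _ => 1) 1 (measurable_const.indicator hs) (fun x => by
      by_cases hx : x ∈ s <;> simp [hx])
    have e : ∀ u : α → ℝ, ∫ x, u x * s.indicator (fun _ => (1 : ℝ)) x ∂lam = ∫ x in s, u x ∂lam := by
      intro u
      rw [← integral_indicator hs]
      congr 1 with x
      by_cases hx : x ∈ s <;> simp [hx]
    simpa only [e] using this
  have hhi : ∀ i, Integrable (h i) lam := fun i => (hL i).integrable (by norm_num)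
  have h0 : 0 ≤ᵐ[lam] w := ae_nonneg_of_forall_setIntegral_nonneg hwi fun s hs _ =>
    ge_of_tendsto' (hset s hs) fun i => integral_nonneg fun x => (hI i x).1
  have h1 : w ≤ᵐ[lam] fun _ => (1 : ℝ) :=
    ae_le_of_forall_setIntegral_le hwi (integrable_const 1) fun s hs _ =>
      le_of_tendsto' (hset s hs) fun i =>
        integral_mono (hhi i).integrableOn (integrable_const 1) fun x => (hI i x).2
  have hwm := (Lp.aestronglyMeasurable w).aemeasurable
  refine ⟨fun x => max 0 (min 1 (hwm.mk w x)),
    measurable_const.max (measurable_const.min hwm.measurable_mk),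
    fun x => ⟨le_max_left _ _, max_le zero_le_one (min_le_left _ _)⟩, fun g C hg hC => ?_⟩
  convert key g C hg hC using 2
  refine integral_congr_ae ?_
  filter_upwards [h0, h1, hwm.ae_eq_mk] with x hx0 hx1 hx
  rw [← hx, min_eq_right hx1, max_eq_right (by exact hx0)]

/-- Functions with values in `[0, 1]` have a weak limit along every ultrafilter, tested against
functions of linear growth, with respect to a measure with finite first moment. -/
lemma exists_weak_limit_linGrowth {ι : Type*} (ν : Measure ℝ) [IsFiniteMeasure ν]
    (hν : Integrable (fun x => x) ν) (U : Ultrafilter ι) (h : ι → ℝ → ℝ)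
    (hm : ∀ i, Measurable (h i)) (hI : ∀ i x, h i x ∈ Set.Icc (0 : ℝ) 1) :
    ∃ f : ℝ → ℝ, Measurable f ∧ (∀ x, f x ∈ Set.Icc (0 : ℝ) 1) ∧
      ∀ φ : ℝ → ℝ, Measurable φ → LinGrowth φ →
        Tendsto (fun i => ∫ x, h i x * φ x ∂ν) U (nhds (∫ x, f x * φ x ∂ν)) := by
  have hw : Integrable (fun x : ℝ => 1 + |x|) ν := (integrable_const 1).add hν.abs
  have : IsFiniteMeasure (ν.withDensity fun x => ENNReal.ofReal (1 + |x|)) :=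
    isFiniteMeasure_withDensity_ofReal hw.2
  obtain ⟨f, hfm, hfI, hf⟩ := exists_weak_limit_of_mem_Icc
    (ν.withDensity fun x => ENNReal.ofReal (1 + |x|)) U h hm hI
  refine ⟨f, hfm, hfI, fun φ hφm ⟨C, hC⟩ => ?_⟩
  have hpos : ∀ x : ℝ, 0 < 1 + |x| := fun x => by positivity
  have := hf (fun x => φ x / (1 + |x|)) C (by fun_prop) (fun x => by
    rw [abs_div, abs_of_pos (hpos x), div_le_iff₀ (hpos x)]; exact hC x)
  have e : ∀ u : ℝ → ℝ, ∫ x, u x * (φ x / (1 + |x|)) ∂(ν.withDensity fun x =>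
      ENNReal.ofReal (1 + |x|)) = ∫ x, u x * φ x ∂ν := by
    intro u
    rw [integral_withDensity_eq_integral_toReal_smul (by fun_prop) (by simp)]
    congr 1 with x
    rw [ENNReal.toReal_ofReal (hpos x).le, smul_eq_mul]
    have := (hpos x).ne'
    field_simp
  simpa only [e] using this

/-- A measure dominated by a finite measure has a density with values in `[0, 1]`. -/
lemma exists_density_of_le {α : Type*} [MeasurableSpace α] {ρ κ : Measure α} [IsFiniteMeasure κ]
    (hle : ρ ≤ κ) : ∃ h : α → ℝ, Measurable h ∧ (∀ x, h x ∈ Set.Icc (0 : ℝ) 1) ∧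
      ρ = κ.withDensity fun x => ENNReal.ofReal (h x) := by
  have : IsFiniteMeasure ρ := isFiniteMeasure_of_le κ hle
  refine ⟨fun x => min 1 (ρ.rnDeriv κ x).toReal,
    measurable_const.min (Measure.measurable_rnDeriv ρ κ).ennreal_toReal,
    fun x => ⟨le_min zero_le_one ENNReal.toReal_nonneg, min_le_left _ _⟩, ?_⟩
  conv_lhs => rw [← Measure.withDensity_rnDeriv_eq ρ κ (Measure.absolutelyContinuous_of_le hle)]
  refine withDensity_congr_ae ?_
  filter_upwards [Measure.rnDeriv_le_one_of_le hle] with x hx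
  have hx' : ρ.rnDeriv κ x ≤ 1 := hx
  rw [min_eq_right (ENNReal.toReal_le_of_le_ofReal zero_le_one (by simpa using hx')),
    ENNReal.ofReal_toReal (ne_top_of_le_ne_top ENNReal.one_ne_top hx')]

lemma integral_withDensity_ofReal {α : Type*} [MeasurableSpace α] (κ : Measure α) {h : α → ℝ}
    (hm : Measurable h) (h0 : ∀ x, 0 ≤ h x) (φ : α → ℝ) :
    ∫ x, φ x ∂(κ.withDensity fun x => ENNReal.ofReal (h x)) = ∫ x, h x * φ x ∂κ := by
  rw [integral_withDensity_eq_integral_toReal_smul (by fun_prop) (by simp)]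
  congr 1 with x
  rw [ENNReal.toReal_ofReal (h0 x), smul_eq_mul]

/-- Piecewise linear interpolation of a `1`-Lipschitz function on a grid of mesh `δ`. -/
lemma LipschitzWith.abs_sub_interpolation_le {f : ℝ → ℝ} (hf : LipschitzWith 1 f) (a : ℝ) {δ : ℝ}
    (hδ : 0 < δ) (N : ℕ) (x : ℝ) :
    |f x - (f a + ∑ i ∈ Finset.range N, (f (a + (i + 1 : ℕ) * δ) - f (a + i * δ)) / δ *
      (max (x - (a + i * δ)) 0 - max (x - (a + (i + 1 : ℕ) * δ)) 0))| ≤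
      2 * δ + max (a - x) 0 + max (x - (a + N * δ)) 0 := by
  have hL : ∀ y z, |f y - f z| ≤ |y - z| := fun y z => by
    simpa [Real.dist_eq] using hf.dist_le_mul y z
  set S : ℕ → ℝ := fun N => f a + ∑ i ∈ Finset.range N,
    (f (a + (i + 1 : ℕ) * δ) - f (a + i * δ)) / δ *
      (max (x - (a + i * δ)) 0 - max (x - (a + (i + 1 : ℕ) * δ)) 0) with hS
  have hsucc : ∀ n : ℕ, S (n + 1) = S n + (f (a + (n + 1 : ℕ) * δ) - f (a + n * δ)) / δ *
      (max (x - (a + n * δ)) 0 - max (x - (a + (n + 1 : ℕ) * δ)) 0) := fun n => by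
    simp only [hS, Finset.sum_range_succ]; ring
  have key : ∀ n : ℕ, (a + n * δ ≤ x → S n = f (a + n * δ)) ∧
      (x ≤ a + n * δ → |f x - S n| ≤ 2 * δ + max (a - x) 0) := by
    intro n
    induction n with
    | zero =>
      refine ⟨fun _ => by simp [hS], fun hx => ?_⟩
      have h1 := hL x a
      have h2 : |x - a| = a - x := by
        rw [abs_sub_comm]; exact abs_of_nonneg (by simpa using hx)
      have h3 := le_max_left (a - x) 0
      simp only [hS, Finset.range_zero, Finset.sum_empty, add_zero]
      linarith
    | succ n ih =>
      have hstep : a + ((n + 1 : ℕ) : ℝ) * δ = a + n * δ + δ := by push_cast; ring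
      refine ⟨fun hx => ?_, fun hx => ?_⟩
      · rw [hsucc, ih.1 (by linarith), max_eq_left (by linarith), max_eq_left (by linarith), hstep]
        field_simp
        ring
      · rw [hsucc, max_eq_right (a := x - (a + (n + 1 : ℕ) * δ)) (by linarith)]
        rcases le_total x (a + n * δ) with h | h
        · rw [max_eq_right (by linarith)]
          simpa using ih.2 h
        · rw [ih.1 h, max_eq_left (by linarith), sub_zero, hstep]
          have h1 := hL x (a + n * δ)
          rw [abs_of_nonneg (a := x - (a + n * δ)) (by linarith)] at h1
          have h2 := hL (a + n * δ + δ) (a + n * δ)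
          rw [add_sub_cancel_left, abs_of_pos hδ] at h2
          have h3 : |(f (a + n * δ + δ) - f (a + n * δ)) / δ * (x - (a + n * δ))| ≤ δ := by
            rw [abs_mul, abs_div, abs_of_pos hδ,
              abs_of_nonneg (a := x - (a + n * δ)) (by linarith)]
            calc _ ≤ 1 * (x - (a + n * δ)) := by
                  exact mul_le_mul_of_nonneg_right ((div_le_one hδ).2 h2) (by linarith)
              _ ≤ δ := by linarith
          have h4 := le_max_right (a - x) 0
          calc _ = |(f x - f (a + n * δ)) -
                (f (a + n * δ + δ) - f (a + n * δ)) / δ * (x - (a + n * δ))| := by ring_nf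
            _ ≤ _ := abs_sub _ _
            _ ≤ _ := by linarith
  change |f x - S N| ≤ _
  rcases le_total x (a + N * δ) with h | h
  · have := (key N).2 h
    have := le_max_right (x - (a + N * δ)) 0
    linarith
  · rw [(key N).1 h]
    have h1 := hL x (a + N * δ)
    rw [abs_of_nonneg (a := x - (a + N * δ)) (by linarith)] at h1
    have := le_max_left (x - (a + N * δ)) 0
    have := le_max_right (a - x) 0
    linarith

lemma LinGrowth.integrable {φ : ℝ → ℝ} (hφ : LinGrowth φ) (hm : Measurable φ) {ρ : Measure ℝ}
    (hρ : MemM ρ) : Integrable φ ρ := by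
  obtain ⟨C, hC⟩ := hφ
  have := hρ.1
  exact (((integrable_const 1).add hρ.2.abs).const_mul C).mono' hm.aestronglyMeasurable
    (.of_forall hC)

lemma MemM.mono {ρ κ : Measure ℝ} (hκ : MemM κ) (h : ρ ≤ κ) : MemM ρ :=
  have := hκ.1
  ⟨isFiniteMeasure_of_le κ h, hκ.2.mono_measure h⟩

lemma MemM.add {ρ κ : Measure ℝ} (hρ : MemM ρ) (hκ : MemM κ) : MemM (ρ + κ) :=
  have := hρ.1
  have := hκ.1
  ⟨inferInstance, hρ.2.add_measure hκ.2⟩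

lemma ConvexOn.measurable_of_univ {φ : ℝ → ℝ} (h : ConvexOn ℝ Set.univ φ) : Measurable φ :=
  h.locallyLipschitz.continuous.measurable

lemma linGrowth_const (c : ℝ) : LinGrowth fun _ => c :=
  ⟨|c|, fun x => by nlinarith [abs_nonneg c, abs_nonneg x]⟩

lemma LinGrowth.add {φ ψ : ℝ → ℝ} (hφ : LinGrowth φ) (hψ : LinGrowth ψ) :
    LinGrowth fun x => φ x + ψ x := by
  obtain ⟨C, hC⟩ := hφ
  obtain ⟨D, hD⟩ := hψ
  exact ⟨C + D, fun x => (abs_add_le _ _).trans (by linarith [hC x, hD x])⟩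

lemma linGrowth_max_sub (k : ℝ) : LinGrowth fun x => max (x - k) 0 :=
  ⟨1 + |k|, fun x => by
    rw [abs_of_nonneg (le_max_right _ _)]
    refine max_le ?_ (by positivity)
    nlinarith [abs_nonneg k, abs_nonneg x, le_abs_self x, neg_abs_le k,
      mul_nonneg (abs_nonneg k) (abs_nonneg x)]⟩

lemma linGrowth_max_sub' (k : ℝ) : LinGrowth fun x => max (k - x) 0 :=
  ⟨1 + |k|, fun x => by
    rw [abs_of_nonneg (le_max_right _ _)]
    refine max_le ?_ (by positivity)
    nlinarith [abs_nonneg k, abs_nonneg x, neg_abs_le x, le_abs_self k,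
      mul_nonneg (abs_nonneg k) (abs_nonneg x)]⟩

lemma convexOn_max_sub (k : ℝ) : ConvexOn ℝ Set.univ fun x : ℝ => max (x - k) 0 :=
  ((convexOn_id convex_univ).sub (concaveOn_const k convex_univ)).sup
    (convexOn_const 0 convex_univ)

lemma convexOn_max_sub' (k : ℝ) : ConvexOn ℝ Set.univ fun x : ℝ => max (k - x) 0 :=
  ((convexOn_const k convex_univ).sub (concaveOn_id convex_univ)).sup
    (convexOn_const 0 convex_univ)

/-- The distance of a point to the interval `[-R, R]`, for `0 ≤ R`. -/
def tailFun (R x : ℝ) : ℝ := max (-R - x) 0 + max (x - R) 0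

lemma tailFun_nonneg (R x : ℝ) : 0 ≤ tailFun R x :=
  add_nonneg (le_max_right _ _) (le_max_right _ _)

lemma linGrowth_tailFun (R : ℝ) : LinGrowth (tailFun R) :=
  (linGrowth_max_sub' (-R)).add (linGrowth_max_sub R)

lemma convexOn_tailFun (R : ℝ) : ConvexOn ℝ Set.univ (tailFun R) :=
  (convexOn_max_sub' (-R)).add (convexOn_max_sub R)

lemma tendsto_integral_tailFun {ρ : Measure ℝ} (hρ : MemM ρ) :
    Tendsto (fun R : ℕ => ∫ x, tailFun R x ∂ρ) atTop (nhds 0) := by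
  have h0 : ∀ (R : ℕ) (x : ℝ), |x| ≤ R → tailFun R x = 0 := by
    intro R x hx
    obtain ⟨h1, h2⟩ := abs_le.1 hx
    simp only [tailFun]
    rw [max_eq_right (by linarith), max_eq_right (by linarith), add_zero]
  have := tendsto_integral_of_dominated_convergence (μ := ρ) (F := fun (R : ℕ) x => tailFun R x)
    (f := fun _ => 0) (fun x => |x|)
    (fun R => (convexOn_tailFun R).measurable_of_univ.aestronglyMeasurable) hρ.2.abs
    (fun R => .of_forall fun x => ?_) (.of_forall fun x => ?_)
  · simpa using this
  · rw [Real.norm_eq_abs, abs_of_nonneg (tailFun_nonneg _ _)]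
    have hR : (0 : ℝ) ≤ R := R.cast_nonneg
    rcases le_total |x| R with h | h
    · rw [h0 R x h]; positivity
    · simp only [tailFun]
      rcases le_total 0 x with h' | h'
      · rw [max_eq_right (by linarith), zero_add, abs_of_nonneg h']
        exact max_le (by linarith) h'
      · rw [max_eq_right (a := x - R) (by linarith), add_zero, abs_of_nonpos h']
        exact max_le (by linarith) (by linarith)
  · obtain ⟨N, hN⟩ := exists_nat_ge |x|
    refine tendsto_const_nhds.congr' ?_
    filter_upwards [eventually_ge_atTop N] with R hR
    exact (h0 R x (hN.trans (by exact_mod_cast hR))).symm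

lemma leC.real_univ_eq {μ η : Measure ℝ} (h : leC μ η) : μ.real Set.univ = η.real Set.univ := by
  have h1 := h _ (linGrowth_const 1) (convexOn_const 1 convex_univ)
  have h2 := h _ (linGrowth_const (-1)) (convexOn_const (-1) convex_univ)
  simp only [integral_const, smul_eq_mul, mul_one, mul_neg] at h1 h2
  linarith

lemma leC.antisymm_integral {ρ η : Measure ℝ} (h : leC ρ η) (h' : leC η ρ) {φ : ℝ → ℝ}
    (hφ : LinGrowth φ) (hc : ConvexOn ℝ Set.univ φ) : ∫ x, φ x ∂ρ = ∫ x, φ x ∂η :=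
  le_antisymm (h φ hφ hc) (h' φ hφ hc)

/-- A sequence dominated in convex order whose call potentials converge pointwise converges in
Kantorovich distance. -/
lemma tendsto_W_of_leC {ηn : ℕ → Measure ℝ} {η : Measure ℝ} (hη : MemM η) (hηn : ∀ n, MemM (ηn n))
    (hle : ∀ n, leC (ηn n) η)
    (hconv : ∀ k : ℝ, Tendsto (fun n => ∫ x, max (x - k) 0 ∂(ηn n)) atTop
      (nhds (∫ x, max (x - k) 0 ∂η))) :
    Tendsto (fun n => W (ηn n) η) atTop (nhds 0) := by
  have hfin := hη.1
  have hfinn := fun n => (hηn n).1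
  have hW0 : ∀ n, 0 ≤ W (ηn n) η := fun n => Real.sSup_nonneg fun d hd => by
    obtain ⟨f, -, rfl⟩ := hd
    exact abs_nonneg _
  rw [Metric.tendsto_atTop']
  suffices H : ∀ ε > 0, ∀ᶠ n in atTop, W (ηn n) η ≤ ε by
    intro ε hε
    obtain ⟨N, hN⟩ := eventually_atTop.1 (H (ε / 2) (half_pos hε))
    refine ⟨N, fun n hn => ?_⟩
    rw [Real.dist_eq, sub_zero, abs_of_nonneg (hW0 n)]
    linarith [hN n hn.le]
  intro ε hε
  set m := η.real Set.univ with hm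
  have hm0 : 0 ≤ m := measureReal_nonneg
  obtain ⟨R, hR⟩ := ((tendsto_integral_tailFun hη).eventually_lt_const
    (show (0 : ℝ) < ε / 8 by linarith)).exists
  set δ := ε / (8 * (m + 1)) with hδ
  have hδ0 : 0 < δ := by positivity
  have hδm : δ * m ≤ ε / 8 := by
    rw [hδ, div_mul_eq_mul_div, div_le_div_iff₀ (by positivity) (by norm_num)]
    nlinarith
  obtain ⟨N, hN⟩ := exists_nat_ge (2 * R / δ)
  rw [div_le_iff₀ hδ0] at hN
  set c : ℕ → ℝ → ℝ := fun i x =>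
    max (x - (-R + i * δ)) 0 - max (x - (-R + (i + 1 : ℕ) * δ)) 0 with hc
  have hcall : ∀ (k : ℝ) {ρ : Measure ℝ}, MemM ρ → Integrable (fun x => max (x - k) 0) ρ :=
    fun k ρ hρ => (linGrowth_max_sub k).integrable (convexOn_max_sub k).measurable_of_univ hρ
  have hci : ∀ i {ρ : Measure ℝ}, MemM ρ → Integrable (c i) ρ := fun i ρ hρ =>
    (hcall _ hρ).sub (hcall _ hρ)
  have hcconv : Tendsto (fun n => ∑ i ∈ Finset.range N, |∫ x, c i x ∂(ηn n) - ∫ x, c i x ∂η|)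
      atTop (nhds 0) := by
    rw [show (0 : ℝ) = ∑ i ∈ Finset.range N, 0 by simp]
    refine tendsto_finsetSum _ fun i _ => ?_
    rw [← abs_zero, ← sub_self (∫ x, c i x ∂η)]
    refine ((Tendsto.congr (fun n => (integral_sub (hcall _ (hηn n)) (hcall _ (hηn n))).symm) ?_
      ).sub tendsto_const_nhds).abs
    rw [show ∫ x, c i x ∂η = _ from integral_sub (hcall _ hη) (hcall _ hη)]
    exact (hconv _).sub (hconv _)
  filter_upwards [hcconv.eventually_lt_const (show (0 : ℝ) < ε / 4 by linarith)] with n hn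
  refine Real.sSup_le ?_ hε.le
  rintro d ⟨f, hf, rfl⟩
  set s : ℕ → ℝ := fun i => (f (-R + (i + 1 : ℕ) * δ) - f (-R + i * δ)) / δ with hs
  have hs1 : ∀ i, |s i| ≤ 1 := by
    intro i
    rw [hs, abs_div, abs_of_pos hδ0, div_le_one hδ0]
    have := hf.dist_le_mul (-R + (i + 1 : ℕ) * δ) (-R + i * δ)
    rw [Real.dist_eq, Real.dist_eq, NNReal.coe_one, one_mul] at this
    refine this.trans (le_of_eq ?_)
    rw [show -(R : ℝ) + (i + 1 : ℕ) * δ - (-R + i * δ) = δ by push_cast; ring, abs_of_pos hδ0]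
  set F : ℝ → ℝ := fun x => f (-R) + ∑ i ∈ Finset.range N, s i * c i x with hF
  have happrox : ∀ x, |f x - F x| ≤ 2 * δ + tailFun R x := by
    intro x
    refine (hf.abs_sub_interpolation_le (-R) hδ0 N x).trans ?_
    have : max (x - (-R + N * δ)) 0 ≤ max (x - R) 0 := max_le_max (by linarith) le_rfl
    simp only [tailFun]
    linarith
  have hfi : ∀ {ρ : Measure ℝ}, MemM ρ → Integrable f ρ := fun hρ =>
    LinGrowth.integrable ⟨|f 0| + 1, fun x => by
      have h1 := hf.dist_le_mul x 0
      rw [Real.dist_eq, Real.dist_eq, NNReal.coe_one, one_mul, sub_zero] at h1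
      have h2 := abs_sub_abs_le_abs_sub (f x) (f 0)
      nlinarith [abs_nonneg (f 0), abs_nonneg x, mul_nonneg (abs_nonneg (f 0)) (abs_nonneg x)]⟩
      hf.continuous.measurable hρ
  have hsum : ∀ {ρ : Measure ℝ}, MemM ρ →
      Integrable (fun x => ∑ i ∈ Finset.range N, s i * c i x) ρ := fun hρ =>
    integrable_finsetSum _ fun i _ => (hci i hρ).const_mul _
  have hFi : ∀ {ρ : Measure ℝ}, MemM ρ → Integrable F ρ := fun hρ =>
    have := hρ.1
    (integrable_const _).add (hsum hρ)
  have hT : ∀ {ρ : Measure ℝ}, MemM ρ → Integrable (tailFun R) ρ := fun hρ =>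
    (linGrowth_tailFun R).integrable (convexOn_tailFun R).measurable_of_univ hρ
  have herr : ∀ {ρ : Measure ℝ}, MemM ρ → leC ρ η → ρ.real Set.univ = m →
      |∫ x, f x ∂ρ - ∫ x, F x ∂ρ| ≤ 3 * ε / 8 := by
    intro ρ hρ hρη hmass
    have := hρ.1
    rw [← integral_sub (hfi hρ) (hFi hρ)]
    calc _ ≤ ∫ x, |f x - F x| ∂ρ := abs_integral_le_integral_abs
      _ ≤ ∫ x, (2 * δ + tailFun R x) ∂ρ :=
        integral_mono ((hfi hρ).sub (hFi hρ)).abs ((integrable_const _).add (hT hρ)) happrox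
      _ = 2 * (δ * m) + ∫ x, tailFun R x ∂ρ := by
        rw [integral_add (integrable_const _) (hT hρ), integral_const, hmass, smul_eq_mul]
        ring
      _ ≤ _ := by
        have := hρη _ (linGrowth_tailFun R) (convexOn_tailFun R)
        linarith
  have hFint : ∀ {ρ : Measure ℝ}, MemM ρ → ρ.real Set.univ = m →
      ∫ x, F x ∂ρ = m * f (-R) + ∑ i ∈ Finset.range N, s i * ∫ x, c i x ∂ρ := by
    intro ρ hρ hmass
    have := hρ.1
    rw [hF, integral_add (integrable_const _) (hsum hρ), integral_const, hmass, smul_eq_mul,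
      integral_finsetSum _ fun i _ => (hci i hρ).const_mul _]
    simp only [integral_const_mul]
  have hFdiff : |∫ x, F x ∂(ηn n) - ∫ x, F x ∂η| ≤ ε / 4 := by
    rw [hFint (hηn n) (hle n).real_univ_eq, hFint hη rfl, add_sub_add_left_eq_sub,
      ← Finset.sum_sub_distrib]
    refine (Finset.abs_sum_le_sum_abs _ _).trans ((Finset.sum_le_sum fun i _ => ?_).trans hn.le)
    rw [← mul_sub, abs_mul]
    exact mul_le_of_le_one_left (abs_nonneg _) (hs1 i)
  have e1 := herr (hηn n) (hle n) (hle n).real_univ_eq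
  have e2 := herr hη (fun φ _ _ => le_rfl) rfl
  rw [abs_le] at *
  constructor <;> linarith [e1.1, e1.2, e2.1, e2.2, hFdiff.1, hFdiff.2]

lemma LinGrowth.mul_of_mem_Icc {φ h : ℝ → ℝ} (hφ : LinGrowth φ)
    (hI : ∀ x, h x ∈ Set.Icc (0 : ℝ) 1) : LinGrowth fun x => h x * φ x := by
  obtain ⟨C, hC⟩ := hφ
  refine ⟨C, fun x => ?_⟩
  rw [abs_mul, abs_of_nonneg (hI x).1]
  exact (mul_le_of_le_one_left (abs_nonneg _) (hI x).2).trans (hC x)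

/-- Integrals against parts of measures that are carried by the outside of a large interval are
controlled by the tail function. -/
lemma abs_integral_mul_le_tailFun {ρ : Measure ℝ} (hρ : MemM ρ) {h : ℝ → ℝ} (hm : Measurable h)
    (hI : ∀ x, h x ∈ Set.Icc (0 : ℝ) 1) {φ : ℝ → ℝ} {C : ℝ} (hφ : ∀ x, |φ x| ≤ C * (1 + |x|))
    {R : ℝ} (hR : 1 ≤ R) (hnull : ρ (Set.Icc (-(2 * R)) (2 * R)) = 0) :
    |∫ x, h x * φ x ∂ρ| ≤ 4 * C * ∫ x, h x * tailFun R x ∂ρ := by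
  have hC : 0 ≤ C := by have := (abs_nonneg _).trans (hφ 0); simpa using this
  have hhT : Integrable (fun x => h x * tailFun R x) ρ :=
    ((linGrowth_tailFun R).mul_of_mem_Icc hI).integrable
      (hm.mul (convexOn_tailFun R).measurable_of_univ) hρ
  rw [← integral_const_mul]
  rw [← Real.norm_eq_abs]
  refine norm_integral_le_of_norm_le (hhT.const_mul _) ?_
  filter_upwards [measure_eq_zero_iff_ae_notMem.1 hnull] with x hx
  have hx' : 2 * R ≤ |x| := by
    by_contra! hlt
    exact hx (abs_le.1 hlt.le)
  have htail : |x| - R ≤ tailFun R x := by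
    simp only [tailFun]
    rcases abs_cases x with ⟨h1, -⟩ | ⟨h1, -⟩
    · linarith [le_max_left (x - R) 0, le_max_right (-R - x) 0]
    · linarith [le_max_left (-R - x) 0, le_max_right (x - R) 0]
  rw [norm_mul, Real.norm_eq_abs, Real.norm_eq_abs, abs_of_nonneg (hI x).1]
  have : |φ x| ≤ 4 * C * tailFun R x :=
    (hφ x).trans (by nlinarith [mul_le_mul_of_nonneg_left htail hC])
  calc _ ≤ h x * (4 * C * tailFun R x) := mul_le_mul_of_nonneg_left this (hI x).1
    _ = _ := by ring

/-- If the added mass escapes every compact interval, the shadows converge when tested against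
convex functions. -/
lemma tendsto_integral_shadow {μ ν η : Measure ℝ} {νn ηn : ℕ → Measure ℝ} (hν : MemM ν)
    (hνn : ∀ n, MemM (νn n)) (hη : IsShadow μ ν η) (hηn : ∀ n, IsShadow μ (ν + νn n) (ηn n))
    (hvan : ∀ R : ℝ, ∀ᶠ n in atTop, νn n (Set.Icc (-R) R) = 0) (hle : ∀ n, leC (ηn n) η)
    {φ : ℝ → ℝ} (hφ : LinGrowth φ) (hc : ConvexOn ℝ Set.univ φ) :
    Tendsto (fun n => ∫ x, φ x ∂(ηn n)) atTop (nhds (∫ x, φ x ∂η)) := by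
  have hκ : ∀ n, MemM (ν + νn n) := fun n => hν.add (hνn n)
  have hfin := hν.1
  have hκfin := fun n => (hκ n).1
  have hηM : MemM η := hν.mono hη.2.1
  choose h hm hI hdens using fun n => exists_density_of_le (hηn n).2.1
  have hmulint : ∀ n {ρ : Measure ℝ}, MemM ρ → ∀ {ψ : ℝ → ℝ}, LinGrowth ψ → Measurable ψ →
      Integrable (fun x => h n x * ψ x) ρ := fun n ρ hρ ψ hψ hψm =>
    (hψ.mul_of_mem_Icc (hI n)).integrable ((hm n).mul hψm) hρ
  have hsplit : ∀ n {ψ : ℝ → ℝ}, LinGrowth ψ → Measurable ψ →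
      ∫ x, ψ x ∂(ηn n) = ∫ x, h n x * ψ x ∂ν + ∫ x, h n x * ψ x ∂(νn n) := by
    intro n ψ hψ hψm
    conv_lhs => rw [hdens n]
    rw [integral_withDensity_ofReal _ (hm n) (fun x => (hI n x).1),
      integral_add_measure (hmulint n hν hψ hψm) (hmulint n (hνn n) hψ hψm)]
  have hrem : ∀ {ψ : ℝ → ℝ}, LinGrowth ψ →
      Tendsto (fun n => ∫ x, h n x * ψ x ∂(νn n)) atTop (nhds 0) := by
    rintro ψ ⟨C, hC⟩
    have hC0 : 0 ≤ C := by have := (abs_nonneg _).trans (hC 0); simpa using this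
    rw [Metric.tendsto_nhds]
    intro ε hε
    have hlim := (tendsto_integral_tailFun hηM).const_mul (4 * C)
    rw [mul_zero] at hlim
    obtain ⟨R, hRε, hR1⟩ := ((hlim.eventually_lt_const hε).and (eventually_ge_atTop 1)).exists
    filter_upwards [hvan (2 * R)] with n hn
    rw [Real.dist_eq, sub_zero]
    refine lt_of_le_of_lt ?_ hRε
    refine (abs_integral_mul_le_tailFun (hνn n) (hm n) (hI n) hC (by exact_mod_cast hR1) hn).trans ?_
    refine mul_le_mul_of_nonneg_left ?_ (by linarith)
    refine le_trans ?_ (hle n _ (linGrowth_tailFun R) (convexOn_tailFun R))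
    rw [hsplit n (linGrowth_tailFun R) (convexOn_tailFun R).measurable_of_univ]
    exact le_add_of_nonneg_left
      (integral_nonneg fun x => mul_nonneg (hI n x).1 (tailFun_nonneg _ _))
  rw [tendsto_iff_ultrafilter]
  intro U hU
  obtain ⟨f, hfm, hfI, hf⟩ := exists_weak_limit_linGrowth ν hν.2 U h hm hI
  set η' := ν.withDensity fun x => ENNReal.ofReal (f x) with hη'
  have hlim : ∀ {ψ : ℝ → ℝ}, LinGrowth ψ → Measurable ψ →
      Tendsto (fun n => ∫ x, ψ x ∂(ηn n)) U (nhds (∫ x, ψ x ∂η')) := by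
    intro ψ hψ hψm
    rw [hη', integral_withDensity_ofReal _ hfm (fun x => (hfI x).1)]
    simp only [fun n => hsplit n hψ hψm]
    simpa using (hf ψ hψm hψ).add ((hrem hψ).mono_left hU)
  have hη'ν : η' ≤ ν := by
    conv_rhs => rw [← withDensity_one (μ := ν)]
    exact withDensity_mono (.of_forall fun x => by
      simpa using (hfI x).2)
  have h1 : leC μ η' := fun ψ hψ hψc =>
    ge_of_tendsto' (hlim hψ hψc.measurable_of_univ) fun n => (hηn n).1 ψ hψ hψc
  have h2 : leC η' η := fun ψ hψ hψc =>
    le_of_tendsto' (hlim hψ hψc.measurable_of_univ) fun n => hle n ψ hψ hψc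
  rw [← h2.antisymm_integral (hη.2.2 η' h1 hη'ν) hφ hc]
  exact hlim hφ hc.measurable_of_univ

/-- continuity of the shadow when extra mass is added close to infinity. -/
theorem shadow_add_mass_at_infinity (μ ν : Measure ℝ) [IsFiniteMeasure μ] [IsFiniteMeasure ν]
    (hμ : Integrable (fun x => x) μ) (hν : Integrable (fun x => x) ν)
    (hle : leCP μ ν) (νn : ℕ → Measure ℝ) (hνn : ∀ n, MemM (νn n))
    (hcase : (∀ a : ℝ, ∀ᶠ n in atTop, νn n (Set.Iio a) = 0) ∨
             (∀ a : ℝ, ∀ᶠ n in atTop, νn n (Set.Ioi a) = 0) ∨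
             (∃ A B : ℕ → ℝ, Tendsto A atTop atBot ∧ Tendsto B atTop atTop ∧
               ∀ n, νn n (Set.Icc (A n) (B n)) = 0)) :
    (∀ᶠ n in atTop, leCP μ (ν + νn n)) ∧
    (∀ (η : Measure ℝ) (ηn : ℕ → Measure ℝ), IsShadow μ ν η →
      (∀ n, IsShadow μ (ν + νn n) (ηn n)) →
      Tendsto (fun n => W (ηn n) η) atTop (nhds 0)) := by
  have hνM : MemM ν := ⟨inferInstance, hν⟩
  have hle_add : ∀ n, ν ≤ ν + νn n := fun n => Measure.le_add_right le_rfl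
  refine ⟨.of_forall fun n φ hφ hc h0 => (hle φ hφ hc h0).trans ?_, fun η ηn hη hηn => ?_⟩
  · exact integral_mono_measure (hle_add n) (.of_forall h0)
      (hφ.integrable hc.measurable_of_univ (hνM.add (hνn n)))
  have hvan : ∀ R : ℝ, ∀ᶠ n in atTop, νn n (Set.Icc (-R) R) = 0 := by
    intro R
    rcases hcase with h | h | ⟨A, B, hA, hB, h⟩
    · filter_upwards [h (R + 1)] with n hn
      exact measure_mono_null (fun x hx => Set.mem_Iio.2 (by linarith [hx.2])) hn
    · filter_upwards [h (-R - 1)] with n hn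
      exact measure_mono_null (fun x hx => Set.mem_Ioi.2 (by linarith [hx.1])) hn
    · filter_upwards [hA.eventually_le_atBot (-R), hB.eventually_ge_atTop R] with n hAn hBn
      exact measure_mono_null (Set.Icc_subset_Icc hAn hBn) (h n)
  have hdom : ∀ n, leC (ηn n) η := fun n => (hηn n).2.2 η hη.1 (hη.2.1.trans (hle_add n))
  exact tendsto_W_of_leC (hνM.mono hη.2.1) (fun n => (hνM.add (hνn n)).mono (hηn n).2.1) hdom
    fun k => tendsto_integral_shadow hνM hνn hη hηn hvan hdom (linGrowth_max_sub k)
      (convexOn_max_sub k)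

end
end
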